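/- Let D ⊆ ℂⁿ be a taut domain and X ⊆ ℂⁿ a domain. Suppose there are relatively compact subsets K₁ ⊂ D and K₂ ⊂ X and holomorphic mappings F^k : D → X (k ≥ 1) such that: (i) each F^k is a biholomorphism of D onto F^k(D); (ii) for each k there is a point z^k ∈ K₁ with F^k(z^k) ∈ K₂; (iii) for every compact set L ⊂ X there is an index s = s(L) with F^s(D) ⊇ L. If the Bergman kernel K_X of X satisfies K_X(x,x) ≠ 0 for all x ∈ X, then X is biholomorphic to D. -/

import Mathlib

open MeasureTheory Metric Filter Topology Set
open scoped ENNReal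

noncomputable section

/-- Membership in the Bergman space `A²(Ω)`: holomorphic and square-integrable. -/
def MemA2 {n : ℕ} (Ω : Set (Fin n → ℂ)) (f : (Fin n → ℂ) → ℂ) : Prop :=
  DifferentiableOn ℂ f Ω ∧ MemLp f 2 (volume.restrict Ω)

/-- `K` is the Bergman kernel of `Ω`: the reproducing kernel of `A²(Ω)`. -/
def IsBergmanKernel {n : ℕ} (Ω : Set (Fin n → ℂ)) (K : (Fin n → ℂ) → (Fin n → ℂ) → ℂ) : Prop :=
  (∀ w ∈ Ω, MemA2 Ω fun z => K z w) ∧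
  ∀ f, MemA2 Ω f → ∀ w ∈ Ω, f w = ∫ z in Ω, f z * (starRingEnd ℂ) (K z w)

/-- Wirtinger derivative `∂f/∂z_μ`. -/
def wderiv {n : ℕ} (μ : Fin n) (f : (Fin n → ℂ) → ℂ) (z : Fin n → ℂ) : ℂ :=
  (fderiv ℝ f z (Pi.single μ 1) - Complex.I * fderiv ℝ f z (Pi.single μ Complex.I)) / 2

/-- Wirtinger derivative `∂f/∂z̄_μ`. -/
def wderivBar {n : ℕ} (μ : Fin n) (f : (Fin n → ℂ) → ℂ) (z : Fin n → ℂ) : ℂ :=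
  (fderiv ℝ f z (Pi.single μ 1) + Complex.I * fderiv ℝ f z (Pi.single μ Complex.I)) / 2

/-- One-variable Wirtinger derivative `∂f/∂z`. -/
def wderiv1 (f : ℂ → ℂ) (z : ℂ) : ℂ :=
  (fderiv ℝ f z 1 - Complex.I * fderiv ℝ f z Complex.I) / 2

/-- One-variable Wirtinger derivative `∂f/∂z̄`. -/
def wderiv1Bar (f : ℂ → ℂ) (z : ℂ) : ℂ :=
  (fderiv ℝ f z 1 + Complex.I * fderiv ℝ f z Complex.I) / 2

/-- Bergman metric tensor `g_{μν}(z) = ∂² log K(z,z) / ∂z_μ ∂z̄_ν`. -/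
def bergmanTensor {n : ℕ} (K : (Fin n → ℂ) → (Fin n → ℂ) → ℂ) (μ ν : Fin n)
    (z : Fin n → ℂ) : ℂ :=
  wderiv μ (fun w => wderivBar ν (fun u => Complex.log (K u u)) w) z

/-- The hermitian quadratic form of the Bergman metric. -/
def bergmanQuad {n : ℕ} (K : (Fin n → ℂ) → (Fin n → ℂ) → ℂ) (z ξ : Fin n → ℂ) : ℝ :=
  (∑ μ, ∑ ν, bergmanTensor K μ ν z * ξ μ * (starRingEnd ℂ) (ξ ν)).re

/-- The Bergman metric `b_Ω(z,ξ)`. -/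
def bergmanMetric {n : ℕ} (K : (Fin n → ℂ) → (Fin n → ℂ) → ℂ) (z ξ : Fin n → ℂ) : ℝ :=
  Real.sqrt (bergmanQuad K z ξ)

/-- Piecewise-`C¹` curves on `[0,1]`. -/
def PiecewiseC1 {n : ℕ} (γ : ℝ → (Fin n → ℂ)) : Prop :=
  ContinuousOn γ (Set.Icc 0 1) ∧
  ∃ (k : ℕ) (t : Fin (k + 1) → ℝ), StrictMono t ∧ t 0 = 0 ∧ t (Fin.last k) = 1 ∧
    ∀ i : Fin k, ContDiffOn ℝ 1 γ (Set.Icc (t i.castSucc) (t i.succ))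

/-- The Bergman length of a curve. -/
def bergmanLength {n : ℕ} (K : (Fin n → ℂ) → (Fin n → ℂ) → ℂ) (γ : ℝ → (Fin n → ℂ)) : ℝ :=
  ∫ t in (0:ℝ)..1, bergmanMetric K (γ t) (deriv γ t)

/-- The Bergman pseudodistance of `Ω`. -/
def bergmanDist {n : ℕ} (Ω : Set (Fin n → ℂ)) (K : (Fin n → ℂ) → (Fin n → ℂ) → ℂ)
    (z w : Fin n → ℂ) : ℝ :=
  sInf { L : ℝ | ∃ γ : ℝ → (Fin n → ℂ), γ 0 = z ∧ γ 1 = w ∧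
    (∀ t ∈ Set.Icc (0:ℝ) 1, γ t ∈ Ω) ∧ PiecewiseC1 γ ∧ L = bergmanLength K γ }

/-- The Bergman ball `B_Ω(p,r)`. -/
def bergmanBall {n : ℕ} (Ω : Set (Fin n → ℂ)) (K : (Fin n → ℂ) → (Fin n → ℂ) → ℂ)
    (p : Fin n → ℂ) (r : ℝ) : Set (Fin n → ℂ) :=
  { z ∈ Ω | bergmanDist Ω K p z < r }

/-- The Bergman pseudodistance is an honest distance. -/
def BergmanDistIsDistance {n : ℕ} (Ω : Set (Fin n → ℂ))
    (K : (Fin n → ℂ) → (Fin n → ℂ) → ℂ) : Prop :=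
  ∀ z ∈ Ω, ∀ w ∈ Ω, z ≠ w → 0 < bergmanDist Ω K z w

/-- `Ω` is complete with respect to the Bergman distance. -/
def BergmanComplete {n : ℕ} (Ω : Set (Fin n → ℂ))
    (K : (Fin n → ℂ) → (Fin n → ℂ) → ℂ) : Prop :=
  ∀ x : ℕ → (Fin n → ℂ), (∀ k, x k ∈ Ω) →
    (∀ ε : ℝ, 0 < ε → ∃ N, ∀ k ≥ N, ∀ l ≥ N, bergmanDist Ω K (x k) (x l) < ε) →
    ∃ p ∈ Ω, Filter.Tendsto (fun k => bergmanDist Ω K (x k) p) Filter.atTop (nhds 0)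

/-- The Euclidean unit ball `𝔹ⁿ ⊂ ℂⁿ`. -/
def euclUnitBall (n : ℕ) : Set (Fin n → ℂ) :=
  { z | ∑ μ, ‖z μ‖ ^ 2 < 1 }

/-- The Bergman–Fridman invariant `h_X(p)`. -/
def fridmanInv {n : ℕ} (Ω : Set (Fin n → ℂ)) (K : (Fin n → ℂ) → (Fin n → ℂ) → ℂ)
    (p : Fin n → ℂ) : ℝ :=
  sInf { c : ℝ | ∃ r : ℝ, 0 < r ∧ c = 1 / r ∧ ∃ f : (Fin n → ℂ) → (Fin n → ℂ),
    DifferentiableOn ℂ f (euclUnitBall n) ∧ Set.InjOn f (euclUnitBall n) ∧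
    f '' euclUnitBall n ⊆ Ω ∧ bergmanBall Ω K p r ⊆ f '' euclUnitBall n }

/-- Biholomorphic equivalence of domains in `ℂⁿ` (an injective holomorphic map of `ℂⁿ`
restricted to a domain is automatically a biholomorphism onto its image). -/
def Biholomorphic {n : ℕ} (U V : Set (Fin n → ℂ)) : Prop :=
  ∃ f : (Fin n → ℂ) → (Fin n → ℂ),
    DifferentiableOn ℂ f U ∧ Set.InjOn f U ∧ f '' U = V

/-- The Levi form of a real-valued function `ρ` at `p` in direction `ξ`. -/
def leviForm {n : ℕ} (ρ : (Fin n → ℂ) → ℝ) (p ξ : Fin n → ℂ) : ℝ :=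
  (∑ μ, ∑ ν, wderiv μ (fun w => wderivBar ν (fun u => (ρ u : ℂ)) w) p
      * ξ μ * (starRingEnd ℂ) (ξ ν)).re

/-- The complex tangent space of `{ρ = 0}` at `p`. -/
def complexTangent {n : ℕ} (ρ : (Fin n → ℂ) → ℝ) (p : Fin n → ℂ) : Set (Fin n → ℂ) :=
  { ξ | ∑ μ, wderiv μ (fun u => (ρ u : ℂ)) p * ξ μ = 0 }

/-- Strong pseudoconvexity at a boundary point, for defining function `ρ`. -/
def StronglyPseudoconvexAt {n : ℕ} (ρ : (Fin n → ℂ) → ℝ) (p : Fin n → ℂ) : Prop :=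
  ∀ ξ ∈ complexTangent ρ p, ξ ≠ 0 → 0 < leviForm ρ p ξ

/-- `ρ` is a (global) defining function for `D`. -/
def IsDefiningFunction {n : ℕ} (D : Set (Fin n → ℂ)) (ρ : (Fin n → ℂ) → ℝ) : Prop :=
  (∀ z, z ∈ D ↔ ρ z < 0) ∧ ∀ z ∈ frontier D, fderiv ℝ ρ z ≠ 0

/-- Plurisubharmonicity via the sub-mean-value property on complex lines. -/
def PlurisubharmonicOn {n : ℕ} (u : (Fin n → ℂ) → ℝ) (Ω : Set (Fin n → ℂ)) : Prop :=
  UpperSemicontinuousOn u Ω ∧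
  ∀ (a b : Fin n → ℂ) (r : ℝ), 0 < r →
    (∀ w : ℂ, ‖w‖ ≤ r → a + w • b ∈ Ω) →
    u a ≤ (1 / (2 * Real.pi)) *
      ∫ θ in (0:ℝ)..(2 * Real.pi), u (a + ((r : ℂ) * Complex.exp (θ * Complex.I)) • b)

/-- Pseudoconvexity: `-log dist(·, ∂D)` is plurisubharmonic on `D`. -/
def IsPseudoconvex {n : ℕ} (D : Set (Fin n → ℂ)) : Prop :=
  PlurisubharmonicOn (fun z => -Real.log (Metric.infDist z Dᶜ)) D

/-- Order of vanishing at `0` of a vector-valued map on `ℂ` (`⊤` if it vanishes to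
infinite order). -/
def vanishingOrderC {n : ℕ} (f : ℂ → (Fin n → ℂ)) : ℝ≥0∞ :=
  sInf ((fun m : ℕ => (m : ℝ≥0∞)) '' { m : ℕ | iteratedDeriv m f 0 ≠ 0 })

/-- Order of vanishing at `0` of a real-valued function on `ℂ`. -/
def vanishingOrderR (g : ℂ → ℝ) : ℝ≥0∞ :=
  sInf ((fun m : ℕ => (m : ℝ≥0∞)) '' { m : ℕ | iteratedFDeriv ℝ m g 0 ≠ 0 })

/-- The D'Angelo 1-type of `ρ` at `p`. -/
def dAngeloOneType {n : ℕ} (ρ : (Fin n → ℂ) → ℝ) (p : Fin n → ℂ) : ℝ≥0∞ :=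
  ⨆ (φ : ℂ → (Fin n → ℂ)) (_ : AnalyticAt ℂ φ 0) (_ : φ 0 = p)
    (_ : vanishingOrderC (fun w => φ w - p) ≠ ⊤),
    vanishingOrderR (fun w => ρ (φ w)) / vanishingOrderC (fun w => φ w - p)

/-- The Levi form at `p` has at most one degenerate eigenvalue. -/
def LeviCorankOneAt {n : ℕ} (ρ : (Fin n → ℂ) → ℝ) (p : Fin n → ℂ) : Prop :=
  ∃ V : Submodule ℂ (Fin n → ℂ), n - 2 ≤ Module.finrank ℂ V ∧
    (V : Set (Fin n → ℂ)) ⊆ complexTangent ρ p ∧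
    ∀ ξ ∈ V, ξ ≠ 0 → 0 < leviForm ρ p ξ

/-- A bounded smooth pseudoconvex finite-type Levi corank one domain, with defining
function `ρ`. -/
def IsLeviCorankOneDomain {n : ℕ} (D : Set (Fin n → ℂ)) (ρ : (Fin n → ℂ) → ℝ) : Prop :=
  IsOpen D ∧ IsConnected D ∧ Bornology.IsBounded D ∧ IsPseudoconvex D ∧
  ContDiff ℝ (⊤ : ℕ∞) ρ ∧ IsDefiningFunction D ρ ∧
  (∀ p ∈ frontier D, dAngeloOneType ρ p ≠ ⊤) ∧
  ∀ p ∈ frontier D, LeviCorankOneAt ρ p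

/-- The open unit disc in `ℂ`. -/
def openUnitDisc : Set ℂ := Metric.ball 0 1

/-- Tautness of a domain in `ℂⁿ`. -/
def IsTaut {n : ℕ} (D : Set (Fin n → ℂ)) : Prop :=
  ∀ f : ℕ → ℂ → (Fin n → ℂ),
    (∀ k, DifferentiableOn ℂ (f k) openUnitDisc ∧ f k '' openUnitDisc ⊆ D) →
    ∃ φ : ℕ → ℕ, StrictMono φ ∧
      ((∃ g : ℂ → (Fin n → ℂ), DifferentiableOn ℂ g openUnitDisc ∧ g '' openUnitDisc ⊆ D ∧
          TendstoLocallyUniformlyOn (fun k => f (φ k)) g Filter.atTop openUnitDisc) ∨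
        ∀ S : Set ℂ, IsCompact S → S ⊆ openUnitDisc →
          ∀ L : Set (Fin n → ℂ), IsCompact L → L ⊆ D →
            ∀ᶠ k in Filter.atTop, ∀ w ∈ S, f (φ k) w ∉ L)

/-- Convergence of a sequence of domains in the local Hausdorff sense. -/
def LocalHausdorffConv {n : ℕ} (Ω : ℕ → Set (Fin n → ℂ)) (Ωl : Set (Fin n → ℂ)) : Prop :=
  (∀ S : Set (Fin n → ℂ), IsCompact S → S ⊆ Ωl → ∀ᶠ j in Filter.atTop, S ⊆ Ω j) ∧
  ∀ S : Set (Fin n → ℂ), IsCompact S →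
    (∃ j₀ : ℕ, S ⊆ interior (⋂ j, ⋂ (_ : j₀ ≤ j), Ω j)) → S ⊆ Ωl

/-- A real-valued subharmonic polynomial of degree at most `d` in one complex variable,
containing no harmonic terms. -/
def SubharmonicPolyNoHarm (P : ℂ → ℝ) (d : ℕ) : Prop :=
  (∃ c : Fin (d + 1) → Fin (d + 1) → ℂ,
    (∀ j, c j 0 = 0) ∧ (∀ k, c 0 k = 0) ∧
    ∀ w : ℂ, (P w : ℂ) = ∑ j, ∑ k, c j k * w ^ (j : ℕ) * (starRingEnd ℂ) w ^ (k : ℕ)) ∧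
  ∀ w : ℂ, 0 ≤ (wderiv1 (fun u => wderiv1Bar (fun v => (P v : ℂ)) u) w).re

/-- A strictly subharmonic real polynomial of degree `2` in one complex variable. -/
def StrictlySubharmonicPolyDeg2 (Q : ℂ → ℝ) : Prop :=
  (∃ c : Fin 3 → Fin 3 → ℂ, ∀ w : ℂ,
      (Q w : ℂ) = ∑ j, ∑ k, c j k * w ^ (j : ℕ) * (starRingEnd ℂ) w ^ (k : ℕ)) ∧
  ∀ w : ℂ, 0 < (wderiv1 (fun u => wderiv1Bar (fun v => (Q v : ℂ)) u) w).re

/-- A nontangential cone in `D` with vertex `p0 ∈ ∂D`. -/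
def IsNontangentialCone {n : ℕ} (D Γ : Set (Fin n → ℂ)) (p0 : Fin n → ℂ) : Prop :=
  Γ ⊆ D ∧ p0 ∈ closure Γ ∧
  ∃ C : ℝ, 0 < C ∧ ∀ z ∈ Γ, ‖z - p0‖ ≤ C * Metric.infDist z Dᶜ

/-- The Bergman kernel is positive on the diagonal of `Ω`. -/
def DiagPos {n : ℕ} (Ω : Set (Fin n → ℂ)) (K : (Fin n → ℂ) → (Fin n → ℂ) → ℂ) : Prop :=
  ∀ z ∈ Ω, (K z z).im = 0 ∧ 0 < (K z z).re

/-- The Bergman metric of `Ω` is positive definite. -/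
def BergPosDef {n : ℕ} (Ω : Set (Fin n → ℂ)) (K : (Fin n → ℂ) → (Fin n → ℂ) → ℂ) : Prop :=
  ∀ z ∈ Ω, ∀ ξ : Fin n → ℂ, ξ ≠ 0 → 0 < bergmanMetric K z ξ

/-- The real coordinate directions of `ℂⁿ ≃ ℝ^{2n}`. -/
def realDir {n : ℕ} (μ : Fin (2 * n)) : Fin n → ℂ :=
  Pi.single ⟨(μ : ℕ) / 2, by have := μ.isLt; omega⟩
    (if (μ : ℕ) % 2 = 0 then 1 else Complex.I)

/-- The real coefficients `g̃_{μν}` of the Bergman metric, obtained by polarization. -/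
def realTensor {n : ℕ} (K : (Fin n → ℂ) → (Fin n → ℂ) → ℂ) (μ ν : Fin (2 * n))
    (z : Fin n → ℂ) : ℝ :=
  (bergmanQuad K z (realDir μ + realDir ν) - bergmanQuad K z (realDir μ)
    - bergmanQuad K z (realDir ν)) / 2

/-- The Christoffel symbols `Γ^η_{μν}` of the Bergman metric, in real coordinates. -/
def christoffel {n : ℕ} (K : (Fin n → ℂ) → (Fin n → ℂ) → ℂ) (η μ ν : Fin (2 * n))
    (z : Fin n → ℂ) : ℝ :=
  (1 / 2) * ∑ τ : Fin (2 * n),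
    (fderiv ℝ (realTensor K ν τ) z (realDir μ)
      + fderiv ℝ (realTensor K τ μ) z (realDir ν)
      - fderiv ℝ (realTensor K μ ν) z (realDir τ))
    * (Matrix.of fun a b => realTensor K a b z)⁻¹ τ η

/-- `z0 ∈ ∂D` is a local holomorphic peak point of `D`. -/
def IsLocalPeakPoint {n : ℕ} (D : Set (Fin n → ℂ)) (z0 : Fin n → ℂ) : Prop :=
  ∃ U ∈ nhds z0, ∃ g : (Fin n → ℂ) → ℂ,
    DifferentiableOn ℂ g (U ∩ D) ∧ ContinuousOn g (closure (U ∩ D)) ∧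
    g z0 = 1 ∧ ∀ z ∈ closure (U ∩ D), z ≠ z0 → ‖g z‖ < 1

/-- A real polynomial on `ℂⁿ` containing no pluriharmonic terms. -/
def IsPolyNoPluriharm {n : ℕ} (P : (Fin n → ℂ) → ℝ) : Prop :=
  ∃ (d : ℕ) (c : (Fin n → Fin (d + 1)) → (Fin n → Fin (d + 1)) → ℂ),
    (∀ α β, (∀ j, (β j : ℕ) = 0) → c α β = 0) ∧
    (∀ α β, (∀ j, (α j : ℕ) = 0) → c α β = 0) ∧
    ∀ z, (P z : ℂ) = ∑ α, ∑ β, c α β * (∏ j, z j ^ (α j : ℕ)) *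
      ∏ j, (starRingEnd ℂ) (z j) ^ (β j : ℕ)

section Holomorphic

variable {E F : Type*} [NormedAddCommGroup E] [NormedSpace ℂ E]
  [NormedAddCommGroup F] [NormedSpace ℂ F]

/-- Cauchy estimate for the Fréchet derivative. -/
theorem norm_fderiv_le_of_norm_le_on_ball {f : E → F} {c : E} {R M : ℝ} (hR : 0 < R)
    (hf : DifferentiableOn ℂ f (ball c R)) (hM : ∀ z ∈ ball c R, ‖f z‖ ≤ M) :
    ‖fderiv ℂ f c‖ ≤ 2 * M / R := by
  refine Complex.norm_fderiv_le_div_of_mapsTo_ball hf (fun z hz => ?_) hR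
  rw [mem_closedBall, dist_eq_norm]
  linarith [norm_sub_le (f z) (f c), hM z hz, hM c (mem_ball_self hR)]

/-- Uniform limits of holomorphic maps on a ball: derivatives converge uniformly on the concentric
ball of half the radius, and the limit is holomorphic there. -/
theorem tendstoUniformlyOn_fderiv_half_ball [CompleteSpace F] {ι : Type*} {l : Filter ι} [l.NeBot]
    {f : ι → E → F} {g : E → F} {a : E} {R : ℝ} (hR : 0 < R)
    (hfg : TendstoUniformlyOn f g l (ball a R))
    (hf : ∀ᶠ k in l, DifferentiableOn ℂ (f k) (ball a R)) :
    DifferentiableOn ℂ g (ball a (R / 2)) ∧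
      TendstoUniformlyOn (fun k => fderiv ℂ (f k)) (fderiv ℂ g) l (ball a (R / 2)) := by
  have hsub : ∀ x ∈ ball a (R / 2), ball x (R / 2) ⊆ ball a R := fun x hx =>
    ball_subset_ball' (by rw [mem_ball] at hx; linarith)
  have hhalf : ball a (R / 2) ⊆ ball a R := ball_subset_ball (by linarith)
  have hcau : UniformCauchySeqOn (fun k => fderiv ℂ (f k)) l (ball a (R / 2)) := by
    intro u hu
    obtain ⟨ε, ε0, hε⟩ := Metric.mem_uniformity_dist.1 hu
    have h1 := hfg.uniformCauchySeqOn _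
      (Metric.dist_mem_uniformity (show 0 < ε * R / 8 by positivity))
    filter_upwards [h1, hf.prod_mk hf] with m hm hd x hx
    refine hε ?_
    have hxU : ball a R ∈ 𝓝 x := isOpen_ball.mem_nhds (hhalf hx)
    have e : fderiv ℂ (f m.1) x - fderiv ℂ (f m.2) x = fderiv ℂ (fun y => f m.1 y - f m.2 y) x :=
      (fderiv_fun_sub (hd.1.differentiableAt hxU) (hd.2.differentiableAt hxU)).symm
    rw [dist_eq_norm, e]
    have := norm_fderiv_le_of_norm_le_on_ball (f := fun y => f m.1 y - f m.2 y) (c := x)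
      (R := R / 2) (M := ε * R / 8) (by positivity)
      ((hd.1.sub hd.2).mono (hsub x hx)) (fun z hz => by
        have := hm z (hsub x hx hz)
        rw [← dist_eq_norm]; exact le_of_lt this)
    refine this.trans_lt ?_
    have : 2 * (ε * R / 8) / (R / 2) = ε / 2 := by field_simp; norm_num
    linarith
  have hlim : ∀ x ∈ ball a (R / 2), ∃ A, Tendsto (fun k => fderiv ℂ (f k) x) l (𝓝 A) := fun x hx =>
    cauchy_map_iff_exists_tendsto.1 (hcau.cauchy_map hx)
  choose! g' hg' using hlim
  have hunif := hcau.tendstoUniformlyOn_of_tendsto hg'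
  have hderiv : ∀ x ∈ ball a (R / 2), HasFDerivAt g (g' x) x := by
    intro x hx
    have hxU : ball a (R / 2) ∈ 𝓝 x := isOpen_ball.mem_nhds hx
    refine hasFDerivAt_of_tendstoUniformlyOnFilter (l := l) (f := f)
      (f' := fun k => fderiv ℂ (f k)) (g' := g') (x := x) ?_ ?_ ?_
    · have := tendstoUniformlyOn_iff_tendstoUniformlyOnFilter.1 hunif
      exact this.mono_right (le_principal_iff.2 hxU)
    · filter_upwards [hf.prod_mk (eventually_mem_set.2 hxU)] with n hn
      exact (hn.1.differentiableAt (isOpen_ball.mem_nhds (hhalf hn.2))).hasFDerivAt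
    · filter_upwards [hxU] with y hy
      exact hfg.tendsto_at (hhalf hy)
  exact ⟨fun x hx => (hderiv x hx).differentiableAt.differentiableWithinAt,
    hunif.congr_right fun x hx => (hderiv x hx).fderiv.symm⟩

theorem differentiableOn_of_forall_clm_apply {G : Type*} [NormedAddCommGroup G] [NormedSpace ℂ G]
    [FiniteDimensional ℂ E] {f : G → E →L[ℂ] F} {s : Set G}
    (h : ∀ y, DifferentiableOn ℂ (fun x => f x y) s) : DifferentiableOn ℂ f s := by
  let d := Module.finrank ℂ E
  have hd : d = Module.finrank ℂ (Fin d → ℂ) := (Module.finrank_fin_fun ℂ).symm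
  let e₁ := ContinuousLinearEquiv.ofFinrankEq hd
  let e₂ := (e₁.arrowCongr (1 : F ≃L[ℂ] F)).trans (ContinuousLinearEquiv.piRing (Fin d))
  rw [← Function.id_comp f, ← e₂.symm_comp_self]
  exact e₂.symm.differentiable.comp_differentiableOn (differentiableOn_pi.2 fun i => h _)

/-- The Fréchet derivative of a holomorphic map in finitely many variables is holomorphic. -/
theorem DifferentiableOn.fderiv_of_isOpen [FiniteDimensional ℂ E] [CompleteSpace F]
    {h : E → F} {U : Set E} (hU : IsOpen U) (hh : DifferentiableOn ℂ h U) :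
    DifferentiableOn ℂ (fderiv ℂ h) U := by
  refine differentiableOn_of_forall_clm_apply fun v a ha => ?_
  refine DifferentiableAt.differentiableWithinAt ?_
  have hcont : ContinuousAt h a := (hh.differentiableAt (hU.mem_nhds ha)).continuousAt
  obtain ⟨R, R0, hRU, hRb⟩ : ∃ R > 0, ball a (2 * R) ⊆ U ∧
      ∀ x ∈ ball a (2 * R), ‖h x‖ ≤ ‖h a‖ + 1 := by
    have h1 : ∀ᶠ x in 𝓝 a, x ∈ U ∧ ‖h x‖ ≤ ‖h a‖ + 1 :=
      (hU.eventually_mem ha).and ((hcont.norm.eventually_lt_const (lt_add_one _)).mono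
        fun _ h => h.le)
    obtain ⟨R, R0, hR⟩ := Metric.eventually_nhds_iff_ball.1 h1
    refine ⟨R / 2, by positivity, ?_, ?_⟩ <;> rw [show 2 * (R / 2) = R by ring]
    exacts [fun x hx => (hR x hx).1, fun x hx => (hR x hx).2]
  set M := ‖h a‖ + 1
  have hsub : ∀ x ∈ ball a R, ball x R ⊆ ball a (2 * R) := fun x hx =>
    ball_subset_ball' (by rw [mem_ball] at hx; linarith)
  have hsub' : ball a R ⊆ ball a (2 * R) := ball_subset_ball (by linarith)
  have hdiff : ∀ x ∈ ball a (2 * R), DifferentiableAt ℂ h x := fun x hx =>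
    hh.differentiableAt (hU.mem_nhds (hRU hx))
  have htaylor : ∀ x ∈ ball a R, ∀ w ∈ ball x R,
      ‖h w - h x - fderiv ℂ h x (w - x)‖ ≤ 4 * M * (‖w - x‖ / R) ^ 2 := by
    intro x hx w hw
    have hB : ‖fderiv ℂ h x‖ ≤ 2 * M / R :=
      norm_fderiv_le_of_norm_le_on_ball R0
        (fun y hy => (hdiff y (hsub x hx hy)).differentiableWithinAt)
        fun y hy => hRb y (hsub x hx hy)
    have := Complex.dist_le_mul_div_pow_of_mapsTo_ball_of_isLittleO (n := 1) (R₁ := R)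
      (R₂ := 4 * M) (c := x) (z := w) (f := fun w => h w - h x - fderiv ℂ h x (w - x))
      (fun y hy => (((hdiff y (hsub x hx hy)).sub_const _).sub
        ((fderiv ℂ h x).differentiableAt.comp y
          (differentiableAt_id.sub_const x))).differentiableWithinAt)
      (fun y hy => ?_) ?_ hw
    · simpa [dist_eq_norm] using this
    · simp only [sub_self, map_zero, mem_closedBall, dist_zero_right]
      have h1 := hRb y (hsub x hx hy)
      have h2 := hRb x (hsub' hx)
      have h3 : ‖fderiv ℂ h x (y - x)‖ ≤ 2 * M := by
        refine ((fderiv ℂ h x).le_opNorm _).trans ?_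
        have h4 : ‖y - x‖ ≤ R := by rw [← dist_eq_norm]; exact (mem_ball.1 hy).le
        calc _ ≤ 2 * M / R * R := by gcongr
          _ = 2 * M := by field_simp
      linarith [norm_sub_le (h y - h x) (fderiv ℂ h x (y - x)), norm_sub_le (h y) (h x)]
    · simpa using ((hdiff x (hsub' hx)).hasFDerivAt.isLittleO).trans_isBigO
        (Asymptotics.isBigO_refl _ _).norm_right
  have key := tendstoUniformlyOn_fderiv_half_ball (l := 𝓝[≠] (0 : ℂ)) (a := a) (R := R)
    (f := fun s x => s⁻¹ • (h (x + s • v) - h x)) (g := fun x => fderiv ℂ h x v) R0 ?_ ?_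
  · exact key.1.differentiableAt (ball_mem_nhds a (by positivity))
  · rw [Metric.tendstoUniformlyOn_iff]
    intro ε ε0
    have h1 : Tendsto (fun s : ℂ => 4 * M * ‖s‖ * (‖v‖ / R) ^ 2) (𝓝[≠] 0) (𝓝 0) := by
      have : ContinuousAt (fun s : ℂ => 4 * M * ‖s‖ * (‖v‖ / R) ^ 2) 0 := by fun_prop
      simpa using this.tendsto.mono_left nhdsWithin_le_nhds
    have h2 : Tendsto (fun s : ℂ => ‖s • v‖) (𝓝[≠] 0) (𝓝 0) := by
      have : ContinuousAt (fun s : ℂ => ‖s • v‖) 0 := by fun_prop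
      simpa using this.tendsto.mono_left nhdsWithin_le_nhds
    filter_upwards [h1.eventually_lt_const ε0, h2.eventually_lt_const R0, self_mem_nhdsWithin]
      with s hs1 hs2 hs0 x hx
    have hs0 : s ≠ 0 := hs0
    have h3 := htaylor x hx (x + s • v) (by simpa [dist_eq_norm] using hs2)
    rw [add_sub_cancel_left] at h3
    rw [dist_comm, dist_eq_norm]
    have e : s⁻¹ • (h (x + s • v) - h x) - fderiv ℂ h x v
        = s⁻¹ • (h (x + s • v) - h x - fderiv ℂ h x (s • v)) := by
      rw [map_smul, smul_sub s⁻¹ _ (s • _), smul_smul, inv_mul_cancel₀ hs0, one_smul]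
    rw [e, norm_smul, norm_inv]
    have hs0' : 0 < ‖s‖ := norm_pos_iff.2 hs0
    refine lt_of_le_of_lt ?_ hs1
    rw [inv_mul_le_iff₀ hs0']
    refine h3.trans (le_of_eq ?_)
    rw [norm_smul]; ring
  · have h2 : Tendsto (fun s : ℂ => ‖s • v‖) (𝓝[≠] 0) (𝓝 0) := by
      have : ContinuousAt (fun s : ℂ => ‖s • v‖) 0 := by fun_prop
      simpa using this.tendsto.mono_left nhdsWithin_le_nhds
    filter_upwards [h2.eventually_lt_const R0] with s hs x hx
    have hxs : x + s • v ∈ ball a (2 * R) := hsub x hx (by simpa [dist_eq_norm] using hs)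
    refine DifferentiableAt.differentiableWithinAt (DifferentiableAt.const_smul (.sub ?_ ?_) _)
    · exact (hdiff _ hxs).comp x (differentiableAt_id.add_const _)
    · exact hdiff _ (hsub' hx)

theorem DifferentiableOn.hasStrictFDerivAt_of_isOpen [FiniteDimensional ℂ E] [CompleteSpace F]
    {h : E → F} {U : Set E} (hU : IsOpen U) (hh : DifferentiableOn ℂ h U) {a : E} (ha : a ∈ U) :
    HasStrictFDerivAt h (fderiv ℂ h a) a :=
  hasStrictFDerivAt_of_hasFDerivAt_of_continuousAt
    ((hU.eventually_mem ha).mono fun _ hx =>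
      (hh.differentiableAt (hU.mem_nhds hx)).hasFDerivAt)
    ((hh.fderiv_of_isOpen hU).differentiableAt (hU.mem_nhds ha)).continuousAt

end Holomorphic

section LocalInverse

variable {E F : Type*} [NormedAddCommGroup E] [NormedSpace ℂ E] [FiniteDimensional ℂ E]
  [NormedAddCommGroup F] [NormedSpace ℂ F] [FiniteDimensional ℂ F]

/-- Hurwitz-type statement: if `f k → g` uniformly near `a` and `g` is submersive at `a`, then the
images under `f k` of a fixed ball around `a` eventually contain a fixed ball around `g a`. -/
theorem eventually_closedBall_subset_image {ι : Type*} {l : Filter ι} [l.NeBot]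
    {f : ι → E → F} {g : E → F} {a : E} {R r : ℝ} (hR : 0 < R) (hr : 0 < r)
    (hfg : TendstoUniformlyOn f g l (ball a R))
    (hf : ∀ᶠ k in l, DifferentiableOn ℂ (f k) (ball a R))
    (hg : Function.Surjective (fderiv ℂ g a)) :
    ∃ ε > 0, ∀ᶠ k in l, closedBall (g a) ε ⊆ f k '' closedBall a r := by
  have : CompleteSpace E := FiniteDimensional.complete ℂ E
  have : CompleteSpace F := FiniteDimensional.complete ℂ F
  obtain ⟨hgd, hder⟩ := tendstoUniformlyOn_fderiv_half_ball hR hfg hf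
  have hsurj : (fderiv ℂ g a).range = ⊤ := LinearMap.range_eq_top.2 hg
  set S := (fderiv ℂ g a).nonlinearRightInverseOfSurjective hsurj
  have hS : 0 < (S.nnnorm : ℝ) :=
    NNReal.coe_pos.2 ((fderiv ℂ g a).nonlinearRightInverseOfSurjective_nnnorm_pos hsurj)
  set c : NNReal := S.nnnorm⁻¹ / 2 with hc
  have hc0 : 0 < (c : ℝ) := by rw [hc]; push_cast; positivity
  have hcont : ContinuousAt (fderiv ℂ g) a :=
    ((hgd.fderiv_of_isOpen isOpen_ball).differentiableAt
      (isOpen_ball.mem_nhds (mem_ball_self (by positivity)))).continuousAt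
  obtain ⟨δ, δ0, hδ⟩ := Metric.continuousAt_iff.1 hcont (c / 2) (by positivity)
  set ρ := min (min (δ / 2) (R / 4)) r
  have hρ0 : 0 < ρ := by positivity
  have hρδ : ρ ≤ δ / 2 := (min_le_left _ _).trans (min_le_left _ _)
  have hρR : ρ ≤ R / 4 := (min_le_left _ _).trans (min_le_right _ _)
  have hball : closedBall a ρ ⊆ ball a (R / 2) := closedBall_subset_ball (by linarith)
  refine ⟨c * ρ / 2, by positivity, ?_⟩
  have hpt := (hfg.tendsto_at (mem_ball_self hR))
  filter_upwards [hf, Metric.tendstoUniformlyOn_iff.1 hder (c / 2) (by positivity),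
    Metric.tendsto_nhds.1 hpt (c * ρ / 2) (by positivity)] with k hk hkd hka
  have happ : ApproximatesLinearOn (f k) (fderiv ℂ g a) (closedBall a ρ) c := by
    intro x hx y hy
    refine (convex_closedBall a ρ).norm_image_sub_le_of_norm_hasFDerivWithin_le' (𝕜 := ℂ)
      (f' := fderiv ℂ (f k)) (fun z hz => ?_) (fun z hz => ?_) hy hx
    · exact ((hk.differentiableAt (isOpen_ball.mem_nhds
        (ball_subset_ball (by linarith) (hball hz)))).hasFDerivAt).hasFDerivWithinAt
    · have h1 := hkd z (hball hz)
      have h2 := @hδ z (by rw [mem_closedBall] at hz; linarith)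
      rw [← dist_eq_norm]
      rw [dist_comm] at h1
      linarith [dist_triangle (fderiv ℂ (f k) z) (fderiv ℂ g z) (fderiv ℂ g a)]
  have hs := happ.surjOn_closedBall_of_nonlinearRightInverse S hρ0.le subset_rfl
  have e : ((S.nnnorm : ℝ)⁻¹ - c) * ρ = c * ρ := by rw [hc]; push_cast; ring
  rw [e] at hs
  intro y hy
  refine image_mono (closedBall_subset_closedBall (min_le_right _ _)) (hs ?_)
  rw [mem_closedBall] at hy ⊢
  rw [dist_comm] at hka
  linarith [dist_triangle y (g a) (f k a)]

/-- The inverse of an injective holomorphic map with bijective derivatives is holomorphic. -/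
theorem hasFDerivAt_invFunOn [Nonempty E] {f : E → F} {U : Set E} (hU : IsOpen U)
    (hf : DifferentiableOn ℂ f U) (hinj : InjOn f U) {x : E} (hx : x ∈ U)
    (hb : Function.Bijective (fderiv ℂ f x)) :
    ∃ A : E ≃L[ℂ] F, (A : E →L[ℂ] F) = fderiv ℂ f x ∧
      HasFDerivAt (Function.invFunOn f U) (A.symm : F →L[ℂ] E) (f x) := by
  have : CompleteSpace F := FiniteDimensional.complete ℂ F
  have : CompleteSpace E := FiniteDimensional.complete ℂ E
  let A := (LinearEquiv.ofBijective (fderiv ℂ f x : E →ₗ[ℂ] F) hb).toContinuousLinearEquiv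
  have hA : (A : E →L[ℂ] F) = fderiv ℂ f x := by ext v; rfl
  have hst := hf.hasStrictFDerivAt_of_isOpen hU hx
  rw [← hA] at hst
  refine ⟨A, hA, (hst.to_local_left_inverse ?_).hasFDerivAt⟩
  filter_upwards [hU.mem_nhds hx] with y hy
  exact hinj.leftInvOn_invFunOn hy

theorem isOpen_image_of_surjective_fderiv {f : E → F} {U : Set E} (hU : IsOpen U)
    (hf : DifferentiableOn ℂ f U) (hs : ∀ x ∈ U, Function.Surjective (fderiv ℂ f x)) :
    IsOpen (f '' U) := by
  have : CompleteSpace F := FiniteDimensional.complete ℂ F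
  have : CompleteSpace E := FiniteDimensional.complete ℂ E
  rw [isOpen_iff_mem_nhds]
  rintro _ ⟨x, hx, rfl⟩
  rw [← (hf.hasStrictFDerivAt_of_isOpen hU hx).map_nhds_eq_of_surj
    (LinearMap.range_eq_top.2 (hs x hx))]
  exact image_mem_map (hU.mem_nhds hx)

end LocalInverse

section ZeroSets

variable {E : Type*} [NormedAddCommGroup E] [NormedSpace ℂ E]

theorem eventually_eq_zero_of_iteratedDeriv_eq_zero {U : Set E} (hU : IsOpen U) {h : E → ℂ}
    (hh : DifferentiableOn ℂ h U) {z₀ : E} (hz₀ : z₀ ∈ U)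
    (h0 : ∀ (v : E) (m : ℕ), iteratedDeriv m (fun t : ℂ => h (z₀ + t • v)) 0 = 0) :
    ∀ᶠ x in 𝓝 z₀, h x = 0 := by
  obtain ⟨R, R0, hR⟩ := Metric.isOpen_iff.1 hU z₀ hz₀
  filter_upwards [ball_mem_nhds z₀ (show 0 < R / 2 by positivity)] with w hw
  set v := w - z₀
  have hv : ‖v‖ < R / 2 := by simpa [v, dist_eq_norm] using hw
  have hd : DifferentiableOn ℂ (fun t : ℂ => h (z₀ + t • v)) (ball 0 2) := by
    refine hh.comp (by fun_prop) fun t ht => hR ?_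
    have ht : ‖t‖ < 2 := by simpa using ht
    rw [mem_ball, dist_eq_norm, add_sub_cancel_left, norm_smul]
    nlinarith [norm_nonneg v, norm_nonneg t]
  have := Complex.taylorSeries_eq_on_ball hd (z := 1) (by simp)
  simp only [h0] at this
  simpa [v] using this.symm

/-- A zero set contained in a hyperplane and nonempty fills the hyperplane locally. -/
theorem eventually_eq_zero_on_hyperplane {h : E → ℂ} {W : Set E} (hW : IsOpen W)
    (hh : DifferentiableOn ℂ h W) {a v : E} (ha : a ∈ W) (ha0 : h a = 0) {A : E →L[ℂ] ℂ}
    (hv : A v = 1) (hzero : ∀ᶠ y in 𝓝 a, h y = 0 → A (y - a) = 0) :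
    ∀ᶠ k in 𝓝 (0 : E), A k = 0 → h (a + k) = 0 := by
  obtain ⟨ρ, ρ0, hρ⟩ := Metric.eventually_nhds_iff_ball.1 (hzero.and (hW.eventually_mem ha))
  set r := ρ / (2 * (‖v‖ + 1))
  have r0 : 0 < r := by positivity
  have hrv : r * ‖v‖ < ρ / 2 := by
    have : r * (‖v‖ + 1) = ρ / 2 := by simp only [r]; field_simp
    nlinarith
  have hmem : ∀ k : E, ‖k‖ < ρ / 2 → ∀ t : ℂ, ‖t‖ ≤ r → a + k + t • v ∈ ball a ρ := by
    intro k hk t ht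
    rw [mem_ball, dist_eq_norm, show a + k + t • v - a = k + t • v by abel]
    have h1 : ‖t • v‖ ≤ r * ‖v‖ := by rw [norm_smul]; gcongr
    linarith [norm_add_le k (t • v)]
  have hnz : ∀ k : E, ‖k‖ < ρ / 2 → A k = 0 → ∀ t : ℂ, ‖t‖ ≤ r → t ≠ 0 →
      h (a + k + t • v) ≠ 0 := by
    intro k hk hAk t ht ht0 h0
    have := (hρ _ (hmem k hk t ht)).1 h0
    rw [show a + k + t • v - a = k + t • v by abel, map_add, map_smul, hAk, hv] at this
    simp at this; exact ht0 this
  have hcont : ∀ y ∈ ball a ρ, ContinuousAt h y := fun y hy =>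
    (hh.differentiableAt (hW.mem_nhds (hρ y hy).2)).continuousAt
  have hcontφ : ∀ k : E, ‖k‖ < ρ / 2 → ∀ t : ℂ, ‖t‖ ≤ r →
      ContinuousAt (fun p : E × ℂ => ‖h (a + p.1 + p.2 • v)‖) (k, t) := fun k hk t ht =>
    (ContinuousAt.comp (x := (k, t)) (f := fun p : E × ℂ => a + p.1 + p.2 • v)
      (hcont _ (hmem k hk t ht)) (by fun_prop)).norm
  obtain ⟨c, c0, hc⟩ : ∃ c > 0, ∀ t ∈ sphere (0 : ℂ) r, c < ‖h (a + 0 + t • v)‖ := by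
    have hne : (sphere (0 : ℂ) r).Nonempty := NormedSpace.sphere_nonempty.2 r0.le
    obtain ⟨t₀, ht₀, hmin⟩ := (isCompact_sphere (0 : ℂ) r).exists_isMinOn hne
      (f := fun t => ‖h (a + 0 + t • v)‖) fun t ht => by
        have ht : ‖t‖ = r := by simpa using ht
        exact (ContinuousAt.comp (x := t) (f := fun t : ℂ => ((0 : E), t))
          (hcontφ 0 (by simpa using ρ0) t ht.le) (by fun_prop)).continuousWithinAt
    have ht₀' : ‖t₀‖ = r := by simpa using ht₀
    have hpos : 0 < ‖h (a + 0 + t₀ • v)‖ := norm_pos_iff.2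
      (hnz 0 (by simpa using ρ0) (map_zero A) t₀ ht₀'.le (norm_pos_iff.1 (ht₀' ▸ r0)))
    refine ⟨_, half_pos hpos, fun t ht => ?_⟩
    have : ‖h (a + 0 + t₀ • v)‖ ≤ ‖h (a + 0 + t • v)‖ := hmin ht
    linarith
  have hev1 : ∀ᶠ k in 𝓝 (0 : E), ∀ t ∈ sphere (0 : ℂ) r, c < ‖h (a + k + t • v)‖ := by
    refine (isCompact_sphere (0 : ℂ) r).eventually_forall_of_forall_eventually fun t ht => ?_
    exact (hcontφ 0 (by simpa using ρ0) t (by simpa using (mem_sphere_zero_iff_norm.1 ht).le)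
      ).eventually_const_lt (hc t ht)
  have hev2 : ∀ᶠ k in 𝓝 (0 : E), ‖h (a + k)‖ < c := by
    have : ContinuousAt (fun k => ‖h (a + k)‖) 0 :=
      (ContinuousAt.comp (x := (0 : E)) (f := fun k => a + k)
        (by simpa using hcont a (mem_ball_self ρ0)) (by fun_prop)).norm
    exact this.eventually_lt_const (by simpa [ha0] using c0)
  filter_upwards [hev1, hev2, ball_mem_nhds (0 : E) (half_pos ρ0)] with k h1 h2 hk hAk
  have hk : ‖k‖ < ρ / 2 := by simpa using hk
  by_contra hne
  have hall : ∀ t : ℂ, ‖t‖ ≤ r → h (a + k + t • v) ≠ 0 := by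
    intro t ht
    rcases eq_or_ne t 0 with rfl | ht0
    · simpa using hne
    · exact hnz k hk hAk t ht ht0
  have hdc : DifferentiableOn ℂ (fun t : ℂ => (h (a + k + t • v))⁻¹) (closedBall 0 r) := by
    intro t ht
    have ht : ‖t‖ ≤ r := by simpa using ht
    have h3 : DifferentiableAt ℂ h (a + k + t • v) :=
      hh.differentiableAt (hW.mem_nhds (hρ _ (hmem k hk t ht)).2)
    exact ((h3.comp t (f := fun t : ℂ => a + k + t • v) (by fun_prop)).inv
      (hall t ht)).differentiableWithinAt
  have hmax := Complex.norm_le_of_forall_mem_frontier_norm_le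
    (isBounded_ball (x := (0 : ℂ)) (r := r))
    (DifferentiableOn.diffContOnCl (by rwa [closure_ball _ r0.ne'])) (C := c⁻¹)
    (fun t ht => by
      rw [frontier_ball _ r0.ne'] at ht
      rw [norm_inv]
      exact inv_anti₀ c0 (h1 t ht).le) (z := 0) (subset_closure (mem_ball_self r0))
  simp only [zero_smul, add_zero, norm_inv] at hmax
  have := (inv_le_inv₀ (norm_pos_iff.2 hne) c0).1 hmax
  linarith

/-- A holomorphic function with nonzero differential becomes affine in suitable local holomorphic
coordinates tangent to the identity. -/
theorem exists_straightening [FiniteDimensional ℂ E] {u : E → ℂ} {U : Set E} (hU : IsOpen U)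
    (hu : DifferentiableOn ℂ u U) {z v : E} (hz : z ∈ U) (hv : fderiv ℂ u z v = 1) :
    ∃ (Φ : E → E) (V : Set E), IsOpen V ∧ z ∈ V ∧ DifferentiableOn ℂ Φ V ∧ InjOn Φ V ∧
      MapsTo Φ V U ∧ Φ z = z ∧ HasFDerivAt Φ (ContinuousLinearMap.id ℂ E) z ∧
      ∀ y ∈ V, u (Φ y) = u z + fderiv ℂ u z (y - z) := by
  have : CompleteSpace E := FiniteDimensional.complete ℂ E
  set A := fderiv ℂ u z
  set Ψ : E → E := fun x => x + (u x - u z - A (x - z)) • v with hΨ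
  have hΨd : DifferentiableOn ℂ Ψ U := by
    refine differentiableOn_id.add (((hu.sub_const _).sub ?_).smul_const v)
    exact (A.differentiable.comp (differentiable_id.sub_const z)).differentiableOn
  have hΨz : Ψ z = z := by simp [hΨ]
  have hΨ' : HasFDerivAt Ψ (ContinuousLinearMap.id ℂ E) z := by
    have h1 := (hu.differentiableAt (hU.mem_nhds hz)).hasFDerivAt
    have h2 : HasFDerivAt (fun x => A (x - z)) A z := by
      have := A.hasFDerivAt.comp z ((hasFDerivAt_id z).sub_const z)
      rwa [ContinuousLinearMap.comp_id] at this
    have h3 := (hasFDerivAt_id z).add (((h1.sub_const (u z)).sub h2).smul_const v)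
    refine h3.congr_fderiv ?_
    ext w
    simp [A]
  have hfz : fderiv ℂ Ψ z = ContinuousLinearMap.id ℂ E := hΨ'.fderiv
  have hst := hΨd.hasStrictFDerivAt_of_isOpen hU hz
  have hst' : HasStrictFDerivAt Ψ (ContinuousLinearEquiv.refl ℂ E : E →L[ℂ] E) z := by
    rw [hfz] at hst; exact hst
  set e := hst'.toOpenPartialHomeomorph Ψ
  have hcont : ContinuousAt (fderiv ℂ Ψ) z :=
    ((hΨd.fderiv_of_isOpen hU).differentiableAt (hU.mem_nhds hz)).continuousAt
  have hbij : ∀ᶠ x in 𝓝 z, Function.Bijective (fderiv ℂ Ψ x) := by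
    have h1 : range ((↑) : (E ≃L[ℂ] E) → E →L[ℂ] E) ∈ 𝓝 (fderiv ℂ Ψ z) := by
      rw [hfz]; exact ContinuousLinearEquiv.nhds (ContinuousLinearEquiv.refl ℂ E)
    filter_upwards [hcont.eventually_mem h1] with x hx
    obtain ⟨B, hB⟩ := hx
    rw [← hB]; exact B.bijective
  obtain ⟨V₀, hV₀, hV₀o, hzV₀⟩ := _root_.eventually_nhds_iff.1
    ((hbij.and (hU.eventually_mem hz)).and
      (e.open_source.eventually_mem hst'.mem_toOpenPartialHomeomorph_source))
  have hΨd₀ : DifferentiableOn ℂ Ψ V₀ := hΨd.mono fun x hx => (hV₀ x hx).1.2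
  have hinj : InjOn Ψ V₀ := e.injOn.mono fun x hx => (hV₀ x hx).2
  set Φ := Function.invFunOn Ψ V₀
  have hΦΨ : ∀ x ∈ V₀, Φ (Ψ x) = x := fun x hx => hinj.leftInvOn_invFunOn hx
  refine ⟨Φ, Ψ '' V₀, isOpen_image_of_surjective_fderiv hV₀o hΨd₀ fun x hx =>
    (hV₀ x hx).1.1.2, ⟨z, hzV₀, hΨz⟩, ?_, ?_, ?_, ?_, ?_, ?_⟩
  · rintro _ ⟨x, hx, rfl⟩
    obtain ⟨_, _, h⟩ := hasFDerivAt_invFunOn hV₀o hΨd₀ hinj hx (hV₀ x hx).1.1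
    exact h.differentiableAt.differentiableWithinAt
  · rintro _ ⟨x, hx, rfl⟩ _ ⟨y, hy, rfl⟩ h
    rw [hΦΨ x hx, hΦΨ y hy] at h
    rw [h]
  · rintro _ ⟨x, hx, rfl⟩
    rw [hΦΨ x hx]; exact (hV₀ x hx).1.2
  · have := hΦΨ z hzV₀; rwa [hΨz] at this
  · obtain ⟨B, hB, h⟩ := hasFDerivAt_invFunOn hV₀o hΨd₀ hinj hzV₀ (hV₀ z hzV₀).1.1
    rw [hΨz] at h
    refine h.congr_fderiv ?_
    ext w
    have : B w = w := by
      have := congrArg (fun T : E →L[ℂ] E => T w) (hB.trans hfz)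
      simpa using this
    simpa using (B.symm_apply_eq).2 this.symm
  · rintro _ ⟨x, hx, rfl⟩
    rw [hΦΨ x hx, hΨ]
    simp only [map_sub, map_add, map_smul, smul_eq_mul]
    rw [hv]; ring

/-- If a holomorphic function vanishes on `Z` but not identically near a point of `Z`, then at some
point of `Z` there is a holomorphic function vanishing on `Z` with nonzero differential. -/
theorem exists_fderiv_ne_zero_of_iteratedDeriv_ne_zero [FiniteDimensional ℂ E] {U Z : Set E}
    (hU : IsOpen U) (v : E)
    (m : ℕ) : ∀ (h : E → ℂ) (z₀ : E), DifferentiableOn ℂ h U → z₀ ∈ U → z₀ ∈ Z →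
      (∀ᶠ x in 𝓝 z₀, x ∈ Z → h x = 0) →
      iteratedDeriv m (fun t : ℂ => h (z₀ + t • v)) 0 ≠ 0 →
      ∃ z₁ ∈ U, z₁ ∈ Z ∧ ∃ g : E → ℂ, DifferentiableOn ℂ g U ∧ fderiv ℂ g z₁ ≠ 0 ∧
        ∀ᶠ x in 𝓝 z₁, x ∈ Z → g x = 0 := by
  induction m with
  | zero =>
    intro h z₀ _ _ hz₀Z hZ hne
    refine absurd (hZ.self_of_nhds hz₀Z) ?_
    simpa using hne
  | succ m ih =>
    intro h z₀ hh hz₀ hz₀Z hZ hne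
    set h₁ : E → ℂ := fun x => fderiv ℂ h x v
    have hh₁ : DifferentiableOn ℂ h₁ U :=
      (hh.fderiv_of_isOpen hU).clm_apply (differentiableOn_const v)
    by_cases hcase : ∀ᶠ x in 𝓝 z₀, x ∈ Z → h₁ x = 0
    · refine ih h₁ z₀ hh₁ hz₀ hz₀Z hcase ?_
      rw [iteratedDeriv_succ'] at hne
      have : deriv (fun t : ℂ => h (z₀ + t • v)) =ᶠ[𝓝 0] fun t => h₁ (z₀ + t • v) := by
        have hc : ContinuousAt (fun t : ℂ => z₀ + t • v) 0 := by fun_prop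
        filter_upwards [hc.eventually_mem (hU.mem_nhds (by simpa using hz₀))] with t ht
        have h1 := (hh.differentiableAt (hU.mem_nhds ht)).hasFDerivAt
        have h2 : HasDerivAt (fun t : ℂ => z₀ + t • v) v t := by
          simpa using ((hasDerivAt_id t).smul_const v).const_add z₀
        exact (h1.comp_hasDerivAt t h2).deriv
      rwa [this.iteratedDeriv_eq] at hne
    · have hfr : ∃ᶠ x in 𝓝 z₀, x ∈ Z ∧ h₁ x ≠ 0 := by
        simpa [Filter.not_eventually] using hcase
      obtain ⟨z₁, ⟨h1, h2⟩, h3, h4⟩ :=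
        (hfr.and_eventually (hZ.eventually_nhds.and (hU.eventually_mem hz₀))).exists
      refine ⟨z₁, h4, h1, h, hh, fun h0 => h2 ?_, h3⟩
      simp [h₁, h0]

/-- An injective holomorphic function of one variable has nonvanishing derivative. -/
theorem deriv_ne_zero_of_injOn {f : ℂ → ℂ} {U : Set ℂ} (hU : IsOpen U)
    (hf : DifferentiableOn ℂ f U) (hinj : InjOn f U) {z : ℂ} (hz : z ∈ U) : deriv f z ≠ 0 := by
  intro hz0
  have hfa : AnalyticOnNhd ℂ f U := hf.analyticOnNhd hU
  have hloc : ∀ x ∈ U, ∀ N ∈ 𝓝 x, f '' N ∈ 𝓝 (f x) := by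
    intro x hx N hN
    rcases (hfa x hx).eventually_constant_or_nhds_le_map_nhds with h | h
    · exfalso
      obtain ⟨R, R0, hR⟩ := Metric.eventually_nhds_iff_ball.1 (h.and (hU.eventually_mem hx))
      have h1 : x + (R / 2 : ℝ) ∈ ball x R := by
        simp [abs_of_pos R0]; linarith
      have h2 := hinj (hR _ h1).2 hx (hR _ h1).1
      simp at h2; exact R0.ne' h2
    · exact h (image_mem_map hN)
  have hda : AnalyticAt ℂ (deriv f) z := (hfa z hz).deriv
  have hne : ∀ᶠ x in 𝓝[≠] z, deriv f x ≠ 0 := by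
    refine hda.eventually_eq_zero_or_eventually_ne_zero.resolve_left fun h => ?_
    obtain ⟨R, R0, hR⟩ := Metric.eventually_nhds_iff_ball.1 (h.and (hU.eventually_mem hz))
    have h1 : z + (R / 2 : ℝ) ∈ ball z R := by
      simp [abs_of_pos R0]; linarith
    have h3 := isOpen_ball.is_const_of_deriv_eq_zero (convex_ball z R).isPreconnected
      (hf.mono fun x hx => (hR x hx).2) (fun x hx => (hR x hx).1) h1 (mem_ball_self R0)
    have h2 := hinj (hR _ h1).2 hz h3
    simp at h2; exact R0.ne' h2
  obtain ⟨B, hBsub, hBo, hzB⟩ := _root_.eventually_nhds_iff.1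
    ((eventually_nhdsWithin_iff.1 hne).and (hU.eventually_mem hz))
  have hBinj : InjOn f B := hinj.mono fun x hx => (hBsub x hx).2
  set g := Function.invFunOn f B
  have hgf : ∀ x ∈ B, g (f x) = x := fun x hx => hBinj.leftInvOn_invFunOn hx
  have hgd : ∀ x ∈ B, x ≠ z → DifferentiableAt ℂ g (f x) := by
    intro x hx hxz
    have hst : HasStrictDerivAt f (deriv f x) x := (hfa x (hBsub x hx).2).hasStrictDerivAt
    refine (hst.to_local_left_inverse ((hBsub x hx).1 hxz) ?_).hasDerivAt.differentiableAt
    filter_upwards [hBo.mem_nhds hx] with y hy using hgf y hy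
  have hgc : ContinuousAt g (f z) := by
    intro N hN
    rw [hgf z hzB] at hN
    have := hloc z hz (N ∩ B) (inter_mem hN (hBo.mem_nhds hzB))
    rw [mem_map]
    filter_upwards [this]
    rintro _ ⟨x, ⟨hxN, hxB⟩, rfl⟩
    rw [mem_preimage, hgf x hxB]; exact hxN
  have hga : DifferentiableAt ℂ g (f z) := by
    refine (Complex.analyticAt_of_differentiable_on_punctured_nhds_of_continuousAt ?_
      hgc).differentiableAt
    have := hloc z hz B (hBo.mem_nhds hzB)
    rw [eventually_nhdsWithin_iff]
    filter_upwards [this]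
    rintro _ ⟨x, hx, rfl⟩ hxz
    exact hgd x hx fun h => hxz (by rw [h]; rfl)
  have h1 := hga.hasDerivAt.comp z (hf.differentiableAt (hU.mem_nhds hz)).hasDerivAt
  have h2 : HasDerivAt (g ∘ f) 1 z := (hasDerivAt_id z).congr_of_eventuallyEq
    (by filter_upwards [hBo.mem_nhds hzB] with x hx using hgf x hx)
  have := h1.unique h2
  simp [hz0] at this

end ZeroSets

section Osgood

universe u v

/-- The determinant of a holomorphic family of endomorphisms is holomorphic. -/
theorem DifferentiableOn.continuousLinearMap_det {E F : Type*} [NormedAddCommGroup E]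
    [NormedSpace ℂ E] [NormedAddCommGroup F] [NormedSpace ℂ F] [FiniteDimensional ℂ F]
    {A : E → F →L[ℂ] F} {U : Set E} (hA : DifferentiableOn ℂ A U) :
    DifferentiableOn ℂ (fun x => (A x).det) U := by
  classical
  set b := Module.finBasis ℂ F
  have h1 : ∀ x, (A x).det =
      ∑ σ : Equiv.Perm (Fin (Module.finrank ℂ F)), ((Equiv.Perm.sign σ : ℤ) : ℂ) *
        ∏ i, LinearMap.toContinuousLinearMap (b.coord (σ i)) (A x (b i)) := by
    intro x
    rw [ContinuousLinearMap.det, ← LinearMap.det_toMatrix b, Matrix.det_apply']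
    simp [LinearMap.toMatrix_apply]
  simp only [h1]
  refine DifferentiableOn.fun_sum fun σ _ => (differentiableOn_const _).mul ?_
  have h2 : ∀ i, DifferentiableOn ℂ
      (fun x => LinearMap.toContinuousLinearMap (b.coord (σ i)) (A x (b i))) U := fun i =>
    (LinearMap.toContinuousLinearMap (b.coord (σ i))).differentiable.comp_differentiableOn
      (hA.clm_apply (differentiableOn_const _))
  exact fun x hx => (HasFDerivWithinAt.finsetProd fun i _ =>
    (h2 i x hx).hasFDerivWithinAt).differentiableWithinAt

theorem injective_of_continuousLinearMap_det_ne_zero {F : Type*} [NormedAddCommGroup F]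
    [NormedSpace ℂ F] [FiniteDimensional ℂ F] {A : F →L[ℂ] F} (h : A.det ≠ 0) :
    Function.Injective A := by
  have : IsUnit (A : F →ₗ[ℂ] F) := (LinearMap.isUnit_iff_isUnit_det _).2 (isUnit_iff_ne_zero.2 h)
  exact LinearMap.ker_eq_bot.1 ((LinearMap.isUnit_iff_ker_eq_bot _).1 this)

theorem continuousLinearMap_det_ne_zero_of_injective {F : Type*} [NormedAddCommGroup F]
    [NormedSpace ℂ F] [FiniteDimensional ℂ F] {A : F →L[ℂ] F} (h : Function.Injective A) :
    A.det ≠ 0 := by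
  have : IsUnit (A : F →ₗ[ℂ] F) :=
    (LinearMap.isUnit_iff_ker_eq_bot _).2 (LinearMap.ker_eq_bot.2 h)
  exact ((LinearMap.isUnit_iff_isUnit_det _).1 this).ne_zero

/-- Reduction of Osgood's theorem at a point where the differential does not vanish to one
dimension less. -/
theorem injective_fderiv_of_injOn_of_fderiv_ne_zero {E : Type u} {F : Type v}
    [NormedAddCommGroup E] [NormedSpace ℂ E] [FiniteDimensional ℂ E]
    [NormedAddCommGroup F] [NormedSpace ℂ F] [FiniteDimensional ℂ F] {m : ℕ}
    (hE : Module.finrank ℂ E = m + 1) (hF : Module.finrank ℂ F = m + 1)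
    (ih : ∀ (K : Submodule ℂ E) (K' : Submodule ℂ F), Module.finrank ℂ K = m →
      Module.finrank ℂ K' = m → ∀ (f : K → K') (U : Set K), IsOpen U → DifferentiableOn ℂ f U →
      InjOn f U → ∀ z ∈ U, Function.Injective (fderiv ℂ f z))
    {f : E → F} {U : Set E} (hU : IsOpen U) (hf : DifferentiableOn ℂ f U) (hinj : InjOn f U)
    {z : E} (hz : z ∈ U) (h0 : fderiv ℂ f z ≠ 0) : Function.Injective (fderiv ℂ f z) := by
  set A := fderiv ℂ f z
  have hfz : HasFDerivAt f A z := (hf.differentiableAt (hU.mem_nhds hz)).hasFDerivAt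
  obtain ⟨w, hw⟩ : ∃ w, A w ≠ 0 := by
    by_contra! h
    exact h0 (ContinuousLinearMap.ext h)
  obtain ⟨l, hl⟩ := SeparatingDual.exists_eq_one (R := ℂ) hw
  have hu : DifferentiableOn ℂ (fun x => l (f x)) U := l.differentiable.comp_differentiableOn hf
  have hu' : fderiv ℂ (fun x => l (f x)) z = l.comp A := (l.hasFDerivAt.comp z hfz).fderiv
  obtain ⟨Φ, V, hV, hzV, hΦ, hΦi, hΦU, hΦz, hΦ', hΦl⟩ :=
    exists_straightening hU hu (v := w) hz (by rw [hu']; exact hl)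
  rw [hu'] at hΦl
  set K : Submodule ℂ E := LinearMap.ker (l.comp A : E →ₗ[ℂ] ℂ)
  set K' : Submodule ℂ F := LinearMap.ker (l : F →ₗ[ℂ] ℂ)
  have hK : Module.finrank ℂ K = m := by
    have h1 := Module.Dual.finrank_ker_add_one_of_ne_zero (f := (l.comp A : E →ₗ[ℂ] ℂ))
      (fun h => one_ne_zero (hl.symm.trans (LinearMap.congr_fun h w)))
    exact Nat.succ_injective (h1.trans hE)
  have hK' : Module.finrank ℂ K' = m := by
    have h1 := Module.Dual.finrank_ker_add_one_of_ne_zero (f := (l : F →ₗ[ℂ] ℂ))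
      (fun h => one_ne_zero (hl.symm.trans (LinearMap.congr_fun h (A w))))
    exact Nat.succ_injective (h1.trans hF)
  set P : F →L[ℂ] K' := (ContinuousLinearMap.id ℂ F - l.smulRight (A w)).codRestrict K'
    (fun y => by simp [K', hl])
  have hP : ∀ y, ((P y : K') : F) = y - l y • A w := fun y => rfl
  set g : K → K' := fun k => P (f (Φ (z + k)) - f z)
  set V' : Set K := {k | z + (k : E) ∈ V}
  have hV' : IsOpen V' := hV.preimage (by fun_prop)
  have hgd : DifferentiableOn ℂ g V' := by
    refine P.differentiable.comp_differentiableOn (DifferentiableOn.sub_const ?_ _)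
    refine hf.comp (hΦ.comp (Differentiable.differentiableOn ?_) fun k hk => hk)
      fun k hk => hΦU hk
    exact (differentiable_const z).add K.subtypeL.differentiable
  have hlf : ∀ k ∈ V', l (f (Φ (z + (k : E))) - f z) = 0 := by
    intro k hk
    have h1 : l.comp A k = 0 := k.2
    rw [map_sub, hΦl _ hk, add_sub_cancel_left, add_sub_cancel_left, h1]
  have hgi : InjOn g V' := by
    intro k hk k' hk' h
    have h1 := congrArg (fun y : K' => (y : F)) h
    simp only [g, hP, hlf k hk, hlf k' hk', zero_smul, sub_zero, sub_left_inj] at h1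
    have h2 := hΦi hk hk' (hinj (hΦU hk) (hΦU hk') h1)
    exact Subtype.ext (add_left_cancel h2)
  have h0V : (0 : K) ∈ V' := by simpa [V'] using hzV
  have hg' : HasFDerivAt g (P.comp (A.comp K.subtypeL)) 0 := by
    have h1 : HasFDerivAt (fun k : K => z + (k : E)) K.subtypeL 0 :=
      K.subtypeL.hasFDerivAt.const_add z
    have h2 : HasFDerivAt Φ (ContinuousLinearMap.id ℂ E) (z + ((0 : K) : E)) := by simpa using hΦ'
    have h3 : HasFDerivAt f A (Φ (z + ((0 : K) : E))) := by simpa [hΦz] using hfz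
    have h4 := h3.comp (0 : K) (h2.comp (0 : K) h1)
    rw [ContinuousLinearMap.id_comp] at h4
    exact P.hasFDerivAt.comp (0 : K) (h4.sub_const (f z))
  have hginj := ih K K' hK hK' g V' hV' hgd hgi 0 h0V
  rw [hg'.fderiv] at hginj
  refine (injective_iff_map_eq_zero A).2 fun x hx => ?_
  have hxK : x ∈ K := by simp [K, hx]
  have := (injective_iff_map_eq_zero _).1 hginj ⟨x, hxK⟩ (by simp [hx])
  exact congrArg Subtype.val this

theorem fderiv_ne_zero_of_injOn {E : Type*} [NormedAddCommGroup E] [NormedSpace ℂ E]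
    [FiniteDimensional ℂ E] (hE : 2 ≤ Module.finrank ℂ E) {f : E → E} {U : Set E} (hU : IsOpen U)
    (hf : DifferentiableOn ℂ f U) (hinj : InjOn f U)
    (hdich : ∀ z ∈ U, fderiv ℂ f z ≠ 0 → Function.Injective (fderiv ℂ f z))
    {z : E} (hz : z ∈ U) : fderiv ℂ f z ≠ 0 := by
  intro hz0
  have : Nontrivial E := Module.nontrivial_of_finrank_pos (R := ℂ) (by omega)
  set h : E → ℂ := fun x => (fderiv ℂ f x).det
  have hh : DifferentiableOn ℂ h U := (hf.fderiv_of_isOpen hU).continuousLinearMap_det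
  have hZ : ∀ x ∈ U, h x = 0 → fderiv ℂ f x = 0 := fun x hx hx0 => by
    by_contra hne
    exact continuousLinearMap_det_ne_zero_of_injective (hdich x hx hne) hx0
  have hZ' : ∀ x, fderiv ℂ f x = 0 → h x = 0 := fun x hx => by
    by_contra hne
    obtain ⟨v, hv⟩ := exists_ne (0 : E)
    exact hv (injective_of_continuousLinearMap_det_ne_zero hne (by simp [hx]))
  obtain ⟨v, m, hvm⟩ : ∃ (v : E) (m : ℕ), iteratedDeriv m (fun t : ℂ => h (z + t • v)) 0 ≠ 0 := by
    by_contra! hcon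
    obtain ⟨R, R0, hR⟩ := Metric.eventually_nhds_iff_ball.1
      ((eventually_eq_zero_of_iteratedDeriv_eq_zero hU hh hz hcon).and (hU.eventually_mem hz))
    obtain ⟨y, hy, hyz⟩ : ∃ y ∈ ball z R, y ≠ z := by
      obtain ⟨v, hv⟩ := exists_ne (0 : E)
      have hv' : 0 < ‖v‖ := norm_pos_iff.2 hv
      refine ⟨z + ((R / 2 / ‖v‖ : ℝ) : ℂ) • v, ?_, by simp [hv, R0.ne']⟩
      rw [mem_ball, dist_eq_norm, add_sub_cancel_left, norm_smul, Complex.norm_real, norm_div,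
        Real.norm_of_nonneg (by positivity), norm_norm, div_mul_cancel₀ _ hv'.ne']
      linarith
    have hc := isOpen_ball.is_const_of_fderiv_eq_zero (𝕜 := ℂ) (convex_ball z R).isPreconnected
      (hf.mono fun x hx => (hR x hx).2) (fun x hx => hZ x (hR x hx).2 (hR x hx).1) hy
      (mem_ball_self R0)
    exact hyz (hinj (hR y hy).2 hz hc)
  obtain ⟨z₁, hz₁, hz₁Z, g, hg, hg', hgZ⟩ :=
    exists_fderiv_ne_zero_of_iteratedDeriv_ne_zero (Z := {x | h x = 0}) hU v m h z hh hz
      (hZ' z hz0) (Eventually.of_forall fun x hx => hx) hvm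
  obtain ⟨w, hw⟩ : ∃ w, fderiv ℂ g z₁ w = 1 := by
    obtain ⟨w, hw⟩ : ∃ w, fderiv ℂ g z₁ w ≠ 0 := by
      by_contra! h
      exact hg' (ContinuousLinearMap.ext h)
    exact ⟨(fderiv ℂ g z₁ w)⁻¹ • w, by simp [hw]⟩
  obtain ⟨Φ, V, hV, hzV, hΦ, hΦi, hΦU, hΦz, hΦ', hΦl⟩ := exists_straightening hU hg hz₁ hw
  set A := fderiv ℂ g z₁
  have hgz₁ : g z₁ = 0 := hgZ.self_of_nhds hz₁Z
  have hΦc : ContinuousAt Φ z₁ := hΦ'.continuousAt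
  have hev := eventually_eq_zero_on_hyperplane hV (hh.comp hΦ hΦU) (a := z₁) (v := w) (A := A) hzV
    (by simpa [hΦz] using hz₁Z) hw (by
      have h1 : ∀ᶠ y in 𝓝 z₁, h (Φ y) = 0 → g (Φ y) = 0 := by
        refine hΦc.eventually (p := fun x => h x = 0 → g x = 0) ?_
        rw [hΦz]; exact hgZ
      filter_upwards [h1, hV.eventually_mem hzV] with y hy hyV hy0
      have := hΦl y hyV
      rwa [hy hy0, hgz₁, zero_add, eq_comm] at this)
  obtain ⟨k, hk0, hkA⟩ : ∃ k : E, k ≠ 0 ∧ A k = 0 := by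
    by_contra! hcon
    have hi : Function.Injective (A : E →ₗ[ℂ] ℂ) :=
      (injective_iff_map_eq_zero (A : E →ₗ[ℂ] ℂ)).2 fun x hx => by
        by_contra hx0
        exact hcon x hx0 hx
    have := LinearMap.finrank_le_finrank_of_injective hi
    rw [Module.finrank_self] at this
    omega
  have hline : ∀ᶠ t in 𝓝 (0 : ℂ), h (Φ (z₁ + t • k)) = 0 ∧ z₁ + t • k ∈ V := by
    have hc : Tendsto (fun t : ℂ => t • k) (𝓝 0) (𝓝 (0 : E)) := by
      have : Continuous fun t : ℂ => t • k := by fun_prop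
      simpa using this.tendsto 0
    have hc' : Tendsto (fun t : ℂ => z₁ + t • k) (𝓝 0) (𝓝 z₁) := by
      simpa using hc.const_add z₁
    filter_upwards [hc.eventually hev, hc'.eventually (hV.eventually_mem hzV)] with t h1 h2
    exact ⟨h1 (by simp [hkA]), h2⟩
  obtain ⟨R, R0, hR⟩ := Metric.eventually_nhds_iff_ball.1 hline
  have hd : ∀ t ∈ ball (0 : ℂ) R, HasDerivAt (fun t : ℂ => f (Φ (z₁ + t • k))) 0 t := by
    intro t ht
    have hV₁ := (hR t ht).2
    have h1 : HasDerivAt (fun t : ℂ => z₁ + t • k) k t := by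
      simpa using ((hasDerivAt_id t).smul_const k).const_add z₁
    have h2 := (hΦ.differentiableAt (hV.mem_nhds hV₁)).hasFDerivAt
    have h3 := (hf.differentiableAt (hU.mem_nhds (hΦU hV₁))).hasFDerivAt
    rw [hZ _ (hΦU hV₁) (hR t ht).1] at h3
    exact h3.comp_hasDerivAt t (h2.comp_hasDerivAt t h1)
  have hmem : ((R / 2 : ℝ) : ℂ) ∈ ball (0 : ℂ) R := by
    simp [abs_of_pos R0]; linarith
  have hc := isOpen_ball.is_const_of_deriv_eq_zero (convex_ball (0 : ℂ) R).isPreconnected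
    (fun t ht => (hd t ht).differentiableAt.differentiableWithinAt)
    (fun t ht => (hd t ht).deriv) hmem (mem_ball_self R0)
  have h1 := hΦi (hR _ hmem).2 (hR _ (mem_ball_self R0)).2
    (hinj (hΦU (hR _ hmem).2) (hΦU (hR _ (mem_ball_self R0)).2) hc)
  simp [hk0, R0.ne'] at h1

theorem injective_fderiv_of_injOn_aux (m : ℕ) : ∀ (E : Type u) (F : Type v)
    [NormedAddCommGroup E] [NormedSpace ℂ E] [FiniteDimensional ℂ E]
    [NormedAddCommGroup F] [NormedSpace ℂ F] [FiniteDimensional ℂ F],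
    Module.finrank ℂ E = m → Module.finrank ℂ F = m → ∀ (f : E → F) (U : Set E), IsOpen U →
      DifferentiableOn ℂ f U → InjOn f U → ∀ z ∈ U, Function.Injective (fderiv ℂ f z) := by
  induction m with
  | zero =>
    intro E F _ _ _ _ _ _ hE _ f U _ _ _ z _
    have : Subsingleton E := Module.finrank_zero_iff.1 hE
    exact Function.injective_of_subsingleton _
  | succ m ih =>
    intro E F _ _ _ _ _ _ hE hF f U hU hf hinj z hz
    have hdich : ∀ y ∈ U, fderiv ℂ f y ≠ 0 → Function.Injective (fderiv ℂ f y) := fun y hy =>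
      injective_fderiv_of_injOn_of_fderiv_ne_zero hE hF (fun K K' hK hK' => ih K K' hK hK')
        hU hf hinj hy
    refine hdich z hz ?_
    rcases Nat.eq_zero_or_pos m with rfl | hm
    · let e : E ≃L[ℂ] ℂ := ContinuousLinearEquiv.ofFinrankEq (by simpa using hE)
      let e' : F ≃L[ℂ] ℂ := ContinuousLinearEquiv.ofFinrankEq (by simpa using hF)
      intro h0
      have hd := deriv_ne_zero_of_injOn (f := fun t => e' (f (e.symm t))) (U := e.symm ⁻¹' U)
        (z := e z) (hU.preimage e.symm.continuous)
        (e'.differentiable.comp_differentiableOn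
          (hf.comp e.symm.differentiable.differentiableOn fun x hx => hx))
        (fun x hx y hy h => e.symm.injective (hinj hx hy (e'.injective h))) (by simpa using hz)
      refine hd ?_
      have h1 : HasFDerivAt f (0 : E →L[ℂ] F) (e.symm (e z)) := by
        rw [e.symm_apply_apply, ← h0]
        exact (hf.differentiableAt (hU.mem_nhds hz)).hasFDerivAt
      have h2 := e'.hasFDerivAt.comp (e z) (h1.comp (e z) e.symm.hasFDerivAt)
      simpa [Function.comp_def] using h2.hasDerivAt.deriv
    · let e : F ≃L[ℂ] E := ContinuousLinearEquiv.ofFinrankEq (hF.trans hE.symm)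
      have hd : DifferentiableOn ℂ (fun x => e (f x)) U := e.differentiable.comp_differentiableOn hf
      have hi : InjOn (fun x => e (f x)) U := fun x hx y hy h => hinj hx hy (e.injective h)
      have he : ∀ y ∈ U, fderiv ℂ (fun x => e (f x)) y = (e : F →L[ℂ] E).comp (fderiv ℂ f y) :=
        fun y hy => (e.hasFDerivAt.comp y
          (hf.differentiableAt (hU.mem_nhds hy)).hasFDerivAt).fderiv
      have h1 := fderiv_ne_zero_of_injOn (by omega) hU hd hi (fun y hy hy0 => by
        rw [he y hy] at hy0 ⊢
        exact e.injective.comp (hdich y hy fun h => hy0 (by rw [h, ContinuousLinearMap.comp_zero])))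
        hz
      intro h0
      rw [he z hz, h0, ContinuousLinearMap.comp_zero] at h1
      exact h1 rfl

/-- Osgood's theorem: an injective holomorphic map between equidimensional spaces has invertible
differentials. -/
theorem bijective_fderiv_of_injOn {E F : Type*}
    [NormedAddCommGroup E] [NormedSpace ℂ E] [FiniteDimensional ℂ E]
    [NormedAddCommGroup F] [NormedSpace ℂ F] [FiniteDimensional ℂ F]
    (hEF : Module.finrank ℂ E = Module.finrank ℂ F) {f : E → F} {U : Set E} (hU : IsOpen U)
    (hf : DifferentiableOn ℂ f U) (hinj : InjOn f U) {z : E} (hz : z ∈ U) :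
    Function.Bijective (fderiv ℂ f z) := by
  have h := injective_fderiv_of_injOn_aux _ E F rfl hEF.symm f U hU hf hinj z hz
  exact ⟨h, (LinearMap.injective_iff_surjective_of_finrank_eq_finrank
    (f := (fderiv ℂ f z : E →ₗ[ℂ] F)) hEF).1 h⟩

end Osgood

section Taut

variable {n : ℕ} {D : Set (Fin n → ℂ)}

/-- In a taut domain, discs centred in a fixed compact set have concentric half discs in a common
compact set. -/
theorem IsTaut.exists_isCompact_mapsTo_disc (hD : IsOpen D) (htaut : IsTaut D)
    {K : Set (Fin n → ℂ)} (hK : IsCompact K) (hKD : K ⊆ D) :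
    ∃ C, IsCompact C ∧ C ⊆ D ∧ ∀ φ : ℂ → Fin n → ℂ, DifferentiableOn ℂ φ (ball 0 1) →
      MapsTo φ (ball 0 1) D → φ 0 ∈ K → MapsTo φ (closedBall 0 (1 / 2)) C := by
  by_contra! hcon
  have : LocallyCompactSpace D := hD.locallyCompactSpace
  let Q : CompactExhaustion D := default
  have hQ : ∀ m, IsCompact (Subtype.val '' Q m) := fun m =>
    (Q.isCompact m).image continuous_subtype_val
  have hQD : ∀ m, Subtype.val '' Q m ⊆ D := fun m => Subtype.coe_image_subset D _
  choose φ hφd hφD hφK hφQ using fun m => hcon _ (hQ m) (hQD m)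
  obtain ⟨ψ, hψ, h | h⟩ := htaut φ fun k => ⟨hφd k, (hφD k).image_subset⟩
  · obtain ⟨g, hg, hgD, hlim⟩ := h
    have hsub : closedBall (0 : ℂ) (1 / 2) ⊆ ball 0 1 := closedBall_subset_ball (by norm_num)
    have hunif := (tendstoLocallyUniformlyOn_iff_forall_isCompact isOpen_ball).1 hlim _ hsub
      (isCompact_closedBall _ _)
    have hcpt : IsCompact (g '' closedBall 0 (1 / 2)) :=
      (isCompact_closedBall _ _).image_of_continuousOn (hg.continuousOn.mono hsub)
    obtain ⟨δ, δ0, hδ⟩ := hcpt.exists_cthickening_subset_open hD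
      ((image_mono hsub).trans hgD)
    have hcpt' : IsCompact ((↑) ⁻¹' cthickening δ (g '' closedBall 0 (1 / 2)) : Set D) :=
      Topology.IsInducing.subtypeVal.isCompact_preimage' hcpt.cthickening (by simpa using hδ)
    obtain ⟨N, hN⟩ := Q.exists_superset_of_isCompact hcpt'
    obtain ⟨k, hk, hkN⟩ := ((Metric.tendstoUniformlyOn_iff.1 hunif δ δ0).and
      (eventually_ge_atTop N)).exists
    refine hφQ (ψ k) fun w hw => ?_
    have h1 : φ (ψ k) w ∈ cthickening δ (g '' closedBall 0 (1 / 2)) :=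
      mem_cthickening_of_dist_le _ (g w) _ _ (mem_image_of_mem g hw)
        (by rw [dist_comm]; exact (hk w hw).le)
    exact ⟨⟨_, hδ h1⟩, Q.subset (hkN.trans (hψ.le_apply)) (hN h1), rfl⟩
  · obtain ⟨k, hk⟩ := (h {0} isCompact_singleton (by simp [openUnitDisc]) K hK hKD).exists
    exact hk 0 rfl (hφK (ψ k))

variable {E : Type*} [NormedAddCommGroup E] [NormedSpace ℂ E]

theorem IsTaut.exists_isCompact_mapsTo_ball (hD : IsOpen D) (htaut : IsTaut D)
    {K : Set (Fin n → ℂ)} (hK : IsCompact K) (hKD : K ⊆ D) :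
    ∃ C, IsCompact C ∧ C ⊆ D ∧ ∀ (H : E → Fin n → ℂ) (a : E) (ρ : ℝ), 0 < ρ →
      DifferentiableOn ℂ H (ball a ρ) → MapsTo H (ball a ρ) D → H a ∈ K →
      MapsTo H (closedBall a (ρ / 2)) C := by
  obtain ⟨C, hC, hCD, h⟩ := htaut.exists_isCompact_mapsTo_disc hD hK hKD
  refine ⟨C, hC, hCD, fun H a ρ ρ0 hH hHD hHa x hx => ?_⟩
  have hx : ‖x - a‖ ≤ ρ / 2 := by simpa [dist_eq_norm] using hx
  have hmaps : MapsTo (fun t : ℂ => a + t • (2 : ℂ) • (x - a)) (ball 0 1) (ball a ρ) := by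
    intro t ht
    have ht : ‖t‖ < 1 := by simpa using ht
    rw [mem_ball, dist_eq_norm, add_sub_cancel_left, norm_smul, norm_smul, Complex.norm_ofNat]
    nlinarith [norm_nonneg t, norm_nonneg (x - a)]
  have := h (fun t => H (a + t • (2 : ℂ) • (x - a))) (hH.comp (by fun_prop) hmaps)
    (fun t ht => hHD (hmaps ht)) (by simpa using hHa) (x := 1 / 2) (by simp)
  simpa [smul_smul] using this

/-- Montel-type theorem for maps into a taut domain, along an ultrafilter. -/
theorem IsTaut.exists_tendstoUniformlyOn_of_ultrafilter [FiniteDimensional ℂ E] {ι : Type*}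
    (hD : IsOpen D) (htaut : IsTaut D) (𝒰 : Ultrafilter ι) {Ω : Set E} (hΩ : IsOpen Ω)
    (hΩc : IsPreconnected Ω) {f : ι → E → Fin n → ℂ}
    (hf : ∀ (a : E) (r : ℝ), closedBall a r ⊆ Ω →
      ∀ᶠ j in 𝒰, DifferentiableOn ℂ (f j) (ball a r) ∧ MapsTo (f j) (ball a r) D)
    {x₀ : E} (hx₀ : x₀ ∈ Ω) {y : ι → E} (hy : Tendsto y 𝒰 (𝓝 x₀))
    {K : Set (Fin n → ℂ)} (hK : IsCompact K) (hKD : K ⊆ D) (hfy : ∀ᶠ j in 𝒰, f j (y j) ∈ K) :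
    ∃ g : E → Fin n → ℂ, DifferentiableOn ℂ g Ω ∧ MapsTo g Ω D ∧ ∀ a ∈ Ω, ∃ R > 0,
      ball a R ⊆ Ω ∧ TendstoUniformlyOn f g 𝒰 (ball a R) ∧
        ∀ᶠ j in 𝒰, DifferentiableOn ℂ (f j) (ball a R) := by
  have : ProperSpace E := FiniteDimensional.proper ℂ E
  have hnhd : ∀ a ∈ Ω, ∃ r > 0, closedBall a (2 * r) ⊆ Ω := by
    intro a ha
    obtain ⟨r, r0, hr⟩ := Metric.nhds_basis_closedBall.mem_iff.1 (hΩ.mem_nhds ha)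
    exact ⟨r / 2, half_pos r0, by rwa [mul_div_cancel₀ r two_ne_zero]⟩
  have step : ∀ (a : E) (r : ℝ), 0 < r → closedBall a (2 * r) ⊆ Ω → ∀ (y : ι → E)
      (K : Set (Fin n → ℂ)), IsCompact K → K ⊆ D →
      (∀ᶠ j in 𝒰, dist (y j) a < r / 4 ∧ f j (y j) ∈ K) →
      ∃ C, IsCompact C ∧ C ⊆ D ∧
        ∀ᶠ j in 𝒰, DifferentiableOn ℂ (f j) (ball a (r / 4)) ∧ MapsTo (f j) (ball a (r / 4)) C := by
    intro a r r0 hr y K hK hKD hy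
    obtain ⟨C, hC, hCD, h⟩ := htaut.exists_isCompact_mapsTo_ball (E := E) hD hK hKD
    refine ⟨C, hC, hCD, ?_⟩
    filter_upwards [hf a _ hr, hy] with j ⟨h1, h2⟩ ⟨h3, h4⟩
    refine ⟨h1.mono (ball_subset_ball (by linarith)), fun x hx => ?_⟩
    have hsub : ball (y j) r ⊆ ball a (2 * r) := ball_subset_ball' (by linarith)
    refine h (f j) (y j) r r0 (h1.mono hsub) (h2.mono hsub Subset.rfl) h4 ?_
    rw [mem_closedBall]
    have := dist_triangle_right x (y j) a
    rw [mem_ball] at hx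
    linarith
  set A : Set E := {a ∈ Ω | ∃ K, IsCompact K ∧ K ⊆ D ∧ ∀ᶠ j in 𝒰, f j a ∈ K}
  have hΩA : Ω ⊆ A := by
    refine hΩc.subset_of_closure_inter_subset ?_ ?_ ?_
    · refine Metric.isOpen_iff.2 ?_
      rintro a ⟨ha, K, hK, hKD, hfa⟩
      obtain ⟨r, r0, hr⟩ := hnhd a ha
      obtain ⟨C, hC, hCD, h⟩ := step a r r0 hr (fun _ => a) K hK hKD
        (by filter_upwards [hfa] with j hj; exact ⟨by simpa using r0, hj⟩)
      refine ⟨r / 4, by positivity, fun b hb => ⟨hr ?_, C, hC, hCD, ?_⟩⟩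
      · exact ball_subset_closedBall (ball_subset_ball (by linarith) hb)
      · filter_upwards [h] with j hj using hj.2 hb
    · obtain ⟨r, r0, hr⟩ := hnhd x₀ hx₀
      obtain ⟨C, hC, hCD, h⟩ := step x₀ r r0 hr y K hK hKD
        ((hy.eventually (ball_mem_nhds x₀ (show 0 < r / 4 by positivity))).and hfy)
      refine ⟨x₀, hx₀, hx₀, C, hC, hCD, ?_⟩
      filter_upwards [h] with j hj using hj.2 (mem_ball_self (by positivity))
    · rintro b ⟨hbA, hb⟩
      obtain ⟨r, r0, hr⟩ := hnhd b hb
      obtain ⟨a, ⟨ha, K, hK, hKD, hfa⟩, hba⟩ := Metric.mem_closure_iff.1 hbA (r / 4) (by positivity)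
      obtain ⟨C, hC, hCD, h⟩ := step b r r0 hr (fun _ => a) K hK hKD
        (by filter_upwards [hfa] with j hj; exact ⟨by rwa [dist_comm], hj⟩)
      refine ⟨hb, C, hC, hCD, ?_⟩
      filter_upwards [h] with j hj using hj.2 (mem_ball_self (by positivity))
  have hloc : ∀ a ∈ Ω, ∃ r > 0, ball a r ⊆ Ω ∧ ∃ C, IsCompact C ∧ C ⊆ D ∧
      ∀ᶠ j in 𝒰, DifferentiableOn ℂ (f j) (ball a r) ∧ MapsTo (f j) (ball a r) C := by
    intro a ha
    obtain ⟨-, K, hK, hKD, hfa⟩ := hΩA ha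
    obtain ⟨r, r0, hr⟩ := hnhd a ha
    obtain ⟨C, hC, hCD, h⟩ := step a r r0 hr (fun _ => a) K hK hKD
      (by filter_upwards [hfa] with j hj; exact ⟨by simpa using r0, hj⟩)
    exact ⟨r / 4, by positivity, (ball_subset_closedBall.trans
      (closedBall_subset_closedBall (by linarith))).trans hr, C, hC, hCD, h⟩
  have hlim : ∀ x ∈ Ω, ∃ y ∈ D, Tendsto (fun j => f j x) 𝒰 (𝓝 y) := by
    intro x hx
    obtain ⟨-, K, hK, hKD, hfa⟩ := hΩA hx
    obtain ⟨y, hyK, hy⟩ := hK.ultrafilter_le_nhds (𝒰.map fun j => f j x)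
      (le_principal_iff.2 hfa)
    exact ⟨y, hKD hyK, hy⟩
  choose! g hgD hg using hlim
  have hunif : ∀ a ∈ Ω, ∃ R > 0, ball a R ⊆ Ω ∧ TendstoUniformlyOn f g 𝒰 (ball a R) ∧
      ∀ᶠ j in 𝒰, DifferentiableOn ℂ (f j) (ball a R) := by
    intro a ha
    obtain ⟨r, r0, hr, C, hC, hCD, h⟩ := hloc a ha
    obtain ⟨M, M0, hM⟩ := hC.isBounded.exists_pos_norm_le
    set B := 2 * M / (r / 2)
    have B0 : 0 < B := by positivity
    have hLip : ∀ᶠ j in 𝒰, ∀ x ∈ ball a (r / 2), ∀ y ∈ ball a (r / 2),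
        dist (f j x) (f j y) ≤ B * dist x y := by
      filter_upwards [h] with j ⟨h1, h2⟩ x hx y hy
      rw [dist_eq_norm, dist_eq_norm]
      refine Convex.norm_image_sub_le_of_norm_fderiv_le (𝕜 := ℂ) (s := ball a (r / 2))
        (fun z hz => ?_) (fun z hz => ?_) (convex_ball _ _) hy hx
      · exact h1.differentiableAt (isOpen_ball.mem_nhds (ball_subset_ball (by linarith) hz))
      · have hsub : ball z (r / 2) ⊆ ball a r := ball_subset_ball' (by
          rw [mem_ball] at hz; linarith)
        exact norm_fderiv_le_of_norm_le_on_ball (half_pos r0) (h1.mono hsub)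
          fun w hw => hM _ (h2 (hsub hw))
    have hgLip : ∀ x ∈ ball a (r / 2), ∀ y ∈ ball a (r / 2), dist (g x) (g y) ≤ B * dist x y := by
      intro x hx y hy
      have hs : ball a (r / 2) ⊆ Ω := (ball_subset_ball (by linarith)).trans hr
      refine le_of_tendsto ((hg x (hs hx)).dist (hg y (hs hy))) ?_
      filter_upwards [hLip] with j hj using hj x hx y hy
    refine ⟨r / 4, by positivity, (ball_subset_ball (by linarith)).trans hr, ?_, ?_⟩
    · rw [Metric.tendstoUniformlyOn_iff]
      intro η η0
      obtain ⟨t, ht, htf, htc⟩ := (isCompact_closedBall a (r / 4)).finite_cover_balls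
        (e := η / 3 / B) (by positivity)
      have hta : ∀ p ∈ t, p ∈ ball a (r / 2) := fun p hp =>
        closedBall_subset_ball (by linarith) (ht hp)
      have hpt : ∀ᶠ j in 𝒰, ∀ p ∈ t, dist (g p) (f j p) < η / 3 := by
        refine (eventually_all_finite htf).2 fun p hp => ?_
        have := hg p (hr (ball_subset_ball (by linarith) (hta p hp)))
        filter_upwards [this (ball_mem_nhds _ (show 0 < η / 3 by positivity))] with j hj
        rw [dist_comm]; exact hj
      filter_upwards [hpt, hLip] with j h1 h2 x hx
      obtain ⟨p, hp, hxp⟩ := mem_iUnion₂.1 (htc (ball_subset_closedBall hx))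
      have hxa : x ∈ ball a (r / 2) := ball_subset_ball (by linarith) hx
      have h3 := h1 p hp
      have h4 := h2 p (hta p hp) x hxa
      have h5 := hgLip x hxa p (hta p hp)
      have h6 : B * dist x p < η / 3 := by
        rw [mem_ball, lt_div_iff₀ B0] at hxp; linarith
      rw [dist_comm p x] at h4
      linarith [dist_triangle4 (g x) (g p) (f j p) (f j x)]
    · filter_upwards [h] with j hj using hj.1.mono (ball_subset_ball (by linarith))
  refine ⟨g, fun a ha => ?_, hgD, hunif⟩
  obtain ⟨R, R0, -, h1, h2⟩ := hunif a ha
  exact ((tendstoUniformlyOn_fderiv_half_ball R0 h1 h2).1.differentiableAt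
    (ball_mem_nhds a (half_pos R0))).differentiableWithinAt

end Taut

section BergmanEstimate

variable {n : ℕ}

theorem measurePreserving_add_smul (y : Fin n → ℂ) (c : Circle) :
    MeasurePreserving (fun v : Fin n → ℂ => y + (c : ℂ) • v) := by
  have h1 : MeasurePreserving (fun v : Fin n → ℂ => (c : ℂ) • v) :=
    volume_preserving_pi fun _ => (rotation c).measurePreserving
  exact (measurePreserving_add_left volume y).comp h1

/-- Mean value inequality for the square of the modulus of a holomorphic function. -/
theorem enorm_sq_mul_volume_ball_le_lintegral {u : (Fin n → ℂ) → ℂ} {y : Fin n → ℂ} {R : ℝ}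
    (hu : DifferentiableOn ℂ u (ball y R)) :
    ‖u y‖ₑ ^ 2 * volume (ball (0 : Fin n → ℂ) R) ≤ ∫⁻ z in ball y R, ‖u z‖ₑ ^ 2 := by
  set W : (Fin n → ℂ) → ℝ≥0∞ := (ball y R).indicator fun z => ‖u z‖ₑ ^ 2
  have hW : Measurable W := by
    classical
    have : ContinuousOn (fun z => ‖u z‖ₑ ^ 2) (ball y R) :=
      (ENNReal.continuous_pow 2).comp_continuousOn hu.continuousOn.enorm
    have h2 := this.measurable_piecewise (g := (0 : (Fin n → ℂ) → ℝ≥0∞)) continuousOn_const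
      measurableSet_ball
    rwa [piecewise_eq_indicator] at h2
  have hWint : ∫⁻ z, W z = ∫⁻ z in ball y R, ‖u z‖ₑ ^ 2 := lintegral_indicator measurableSet_ball _
  have hcircle : ∀ v ∈ ball (0 : Fin n → ℂ) R, ENNReal.ofReal (2 * Real.pi) * ‖u y‖ₑ ^ 2 ≤
      ∫⁻ θ in Ioc 0 (2 * Real.pi), W (y + (Circle.exp θ : ℂ) • v) := by
    intro v hv
    have hv : ‖v‖ < R := by simpa using hv
    have hmem : ∀ t ∈ closedBall (0 : ℂ) 1, y + t • v ∈ ball y R := by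
      intro t ht
      have ht : ‖t‖ ≤ 1 := by simpa using ht
      rw [mem_ball, dist_eq_norm, add_sub_cancel_left, norm_smul]
      nlinarith [norm_nonneg v, norm_nonneg t]
    have hd : DifferentiableOn ℂ (fun t : ℂ => u (y + t • v) ^ 2) (closedBall 0 1) :=
      (hu.comp (by fun_prop) hmem).pow 2
    have hav := DiffContOnCl.circleAverage (c := 0) (R := 1)
      (f := fun t : ℂ => u (y + t • v) ^ 2)
      (DifferentiableOn.diffContOnCl (by simpa [closure_ball] using hd))
    rw [Real.circleAverage, intervalIntegral.integral_of_le Real.two_pi_pos.le] at hav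
    have h0 : u y ^ 2 = (2 * Real.pi)⁻¹ • ∫ θ in Ioc 0 (2 * Real.pi),
        u (y + circleMap 0 1 θ • v) ^ 2 := by
      rw [hav]; simp
    have h1 : (2 * Real.pi) • u y ^ 2 = ∫ θ in Ioc 0 (2 * Real.pi),
        u (y + circleMap 0 1 θ • v) ^ 2 := by
      rw [h0, smul_inv_smul₀ Real.two_pi_pos.ne']
    calc ENNReal.ofReal (2 * Real.pi) * ‖u y‖ₑ ^ 2 = ‖(2 * Real.pi) • u y ^ 2‖ₑ := by
          rw [enorm_smul, enorm_pow, Real.enorm_of_nonneg Real.two_pi_pos.le]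
      _ ≤ ∫⁻ θ in Ioc 0 (2 * Real.pi), ‖u (y + circleMap 0 1 θ • v) ^ 2‖ₑ := by
          rw [h1]; exact enorm_integral_le_lintegral_enorm _
      _ = ∫⁻ θ in Ioc 0 (2 * Real.pi), W (y + (Circle.exp θ : ℂ) • v) := by
          refine lintegral_congr fun θ => ?_
          have h2 : circleMap 0 1 θ = (Circle.exp θ : ℂ) := by simp [circleMap]
          rw [h2, enorm_pow]
          exact (indicator_of_mem (hmem _ (by simp)) fun z => ‖u z‖ₑ ^ 2).symm
  have hmeas : Measurable fun p : (Fin n → ℂ) × ℝ => W (y + (Circle.exp p.2 : ℂ) • p.1) := by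
    refine hW.comp (Continuous.measurable ?_)
    fun_prop
  have key : ENNReal.ofReal (2 * Real.pi) * (‖u y‖ₑ ^ 2 * volume (ball (0 : Fin n → ℂ) R)) ≤
      ENNReal.ofReal (2 * Real.pi) * ∫⁻ z, W z := by
    calc ENNReal.ofReal (2 * Real.pi) * (‖u y‖ₑ ^ 2 * volume (ball (0 : Fin n → ℂ) R))
        = ∫⁻ _ in ball (0 : Fin n → ℂ) R, ENNReal.ofReal (2 * Real.pi) * ‖u y‖ₑ ^ 2 := by
          rw [setLIntegral_const, mul_assoc]
      _ ≤ ∫⁻ v in ball (0 : Fin n → ℂ) R, ∫⁻ θ in Ioc 0 (2 * Real.pi),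
            W (y + (Circle.exp θ : ℂ) • v) := setLIntegral_mono' measurableSet_ball hcircle
      _ ≤ ∫⁻ v, ∫⁻ θ in Ioc 0 (2 * Real.pi), W (y + (Circle.exp θ : ℂ) • v) :=
          setLIntegral_le_lintegral _ _
      _ = ∫⁻ θ in Ioc 0 (2 * Real.pi), ∫⁻ v, W (y + (Circle.exp θ : ℂ) • v) :=
          lintegral_lintegral_swap hmeas.aemeasurable
      _ = ∫⁻ _ in Ioc 0 (2 * Real.pi), ∫⁻ z, W z := by
          refine lintegral_congr fun θ => ?_
          exact (measurePreserving_add_smul y (Circle.exp θ)).lintegral_comp hW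
      _ = ENNReal.ofReal (2 * Real.pi) * ∫⁻ z, W z := by
          rw [setLIntegral_const, Real.volume_Ioc, sub_zero, mul_comm]
  rw [← hWint]
  exact (ENNReal.mul_le_mul_iff_right (by simpa using Real.pi_pos) ENNReal.ofReal_ne_top).1 key

theorem abs_det_restrictScalars (A : (Fin n → ℂ) →L[ℂ] (Fin n → ℂ)) :
    ENNReal.ofReal |(A.restrictScalars ℝ).det| = ‖A.det‖ₑ ^ 2 := by
  have h : (A.restrictScalars ℝ).det = ‖A.det‖ ^ 2 := by
    have := LinearMap.det_restrictScalars (R := ℝ) (S := ℂ)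
      (f := (A : (Fin n → ℂ) →ₗ[ℂ] (Fin n → ℂ)))
    rw [Algebra.norm_complex_apply, Complex.normSq_eq_norm_sq] at this
    exact this
  rw [h, abs_of_nonneg (by positivity), ENNReal.ofReal_pow (norm_nonneg _), ofReal_norm]

/-- Square-integrable holomorphic functions bound the Jacobians of holomorphic embeddings at points
where they do not vanish. -/
theorem exists_norm_det_fderiv_le {X : Set (Fin n → ℂ)} {f : (Fin n → ℂ) → ℂ}
    (hfd : DifferentiableOn ℂ f X) (hf : MemLp f 2 (volume.restrict X)) {x : Fin n → ℂ}
    (hx : f x ≠ 0) {R : ℝ} (hR : 0 < R) :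
    ∃ B : ℝ, 0 < B ∧ ∀ (F : (Fin n → ℂ) → Fin n → ℂ) (y : Fin n → ℂ),
      DifferentiableOn ℂ F (ball y R) → InjOn F (ball y R) → MapsTo F (ball y R) X → F y = x →
      ‖(fderiv ℂ F y).det‖ ≤ B := by
  set M := ∫⁻ z in X, ‖f z‖ₑ ^ 2
  have hM : M ≠ ⊤ := by
    have := lintegral_rpow_enorm_lt_top_of_eLpNorm_lt_top two_ne_zero ENNReal.ofNat_ne_top hf.2
    simpa using this.ne
  set c := ‖f x‖ₑ ^ 2 * volume (ball (0 : Fin n → ℂ) R)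
  have hc0 : c ≠ 0 := mul_ne_zero (by simpa using hx) (measure_ball_pos _ _ hR).ne'
  have hct : c ≠ ⊤ := ENNReal.mul_ne_top (by simp) measure_ball_lt_top.ne
  refine ⟨(M / c).toReal + 1, by positivity, fun F y hF hinj hFX hFy => ?_⟩
  have hFd : DifferentiableOn ℂ (fun z => (fderiv ℂ F z).det) (ball y R) :=
    (hF.fderiv_of_isOpen isOpen_ball).continuousLinearMap_det
  have h1 := enorm_sq_mul_volume_ball_le_lintegral
    ((hfd.comp hF hFX).mul hFd)
  have h2 : ∫⁻ z in ball y R, ‖f (F z) * (fderiv ℂ F z).det‖ₑ ^ 2 =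
      ∫⁻ w in F '' ball y R, ‖f w‖ₑ ^ 2 := by
    rw [lintegral_image_eq_lintegral_abs_det_fderiv_mul volume measurableSet_ball
      (f' := fun z => (fderiv ℂ F z).restrictScalars ℝ) (fun z hz =>
        ((hF.differentiableAt (isOpen_ball.mem_nhds hz)).hasFDerivAt.restrictScalars
          ℝ).hasFDerivWithinAt) hinj]
    refine lintegral_congr fun z => ?_
    rw [abs_det_restrictScalars, enorm_mul, mul_pow, mul_comm]
  have h3 : ∫⁻ w in F '' ball y R, ‖f w‖ₑ ^ 2 ≤ M := lintegral_mono_set hFX.image_subset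
  have h4 : ‖(fderiv ℂ F y).det‖ₑ ^ 2 * c ≤ M := by
    refine le_trans (le_of_eq_of_le ?_ h1) (h2.le.trans h3)
    simp only [Pi.mul_apply, Function.comp_apply, hFy, enorm_mul, mul_pow, c]
    ring
  have h5 : ‖(fderiv ℂ F y).det‖ₑ ^ 2 ≤ M / c :=
    (ENNReal.le_div_iff_mul_le (.inl hc0) (.inl hct)).2 h4
  have h6 : ‖(fderiv ℂ F y).det‖ ^ 2 ≤ (M / c).toReal := by
    have := ENNReal.toReal_mono (ENNReal.div_ne_top hM hc0) h5
    simpa using this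
  nlinarith [sq_nonneg (‖(fderiv ℂ F y).det‖ - 1)]

end BergmanEstimate

section Exhaustion

/-- Identity theorem for holomorphic maps. -/
theorem DifferentiableOn.eqOn_of_isPreconnected_of_eventuallyEq {E F : Type*}
    [NormedAddCommGroup E] [NormedSpace ℂ E] [NormedAddCommGroup F] [NormedSpace ℂ F]
    [CompleteSpace F] {f g : E → F} {U : Set E} {z₀ : E} (hU : IsOpen U)
    (hUc : IsPreconnected U) (hf : DifferentiableOn ℂ f U) (hg : DifferentiableOn ℂ g U)
    (hz₀ : z₀ ∈ U) (hfg : f =ᶠ[𝓝 z₀] g) : EqOn f g U := by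
  have hS : IsOpen {y | f =ᶠ[𝓝 y] g} := isOpen_setOfPred_eventually_nhds
  refine fun y hy => Filter.EventuallyEq.eq_of_nhds
    (hUc.subset_of_closure_inter_subset hS ⟨z₀, hz₀, hfg⟩ ?_ hy)
  rintro b ⟨hb, hbU⟩
  obtain ⟨r, hr, hrU⟩ := Metric.isOpen_iff.1 hU b hbU
  obtain ⟨a, ha, hba⟩ := Metric.mem_closure_iff.1 hb (r / 4) (by positivity)
  refine Filter.eventually_of_mem (ball_mem_nhds b (show 0 < r / 4 by positivity)) fun x hx => ?_
  have hline : MapsTo (fun t : ℂ => a + t • (x - a)) (ball 0 (3 / 2)) U := by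
    intro t ht
    apply hrU
    rw [mem_ball_zero_iff] at ht
    rw [mem_ball] at hx ⊢
    have hxa : ‖x - a‖ ≤ r / 4 + r / 4 := by
      rw [← dist_eq_norm]
      linarith [dist_triangle x b a]
    have h1 : Dist.dist (a + t • (x - a)) a ≤ 3 / 2 * (r / 4 + r / 4) := by
      rw [dist_eq_norm, add_sub_cancel_left, norm_smul]
      gcongr
    linarith [dist_triangle (a + t • (x - a)) a b, dist_comm a b]
  have hd : Differentiable ℂ fun t : ℂ => a + t • (x - a) := by fun_prop
  have hcont : Tendsto (fun t : ℂ => a + t • (x - a)) (𝓝 0) (𝓝 a) := by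
    simpa using hd.continuous.tendsto 0
  have key := ((hf.comp hd.differentiableOn hline).analyticOnNhd
    isOpen_ball).eqOn_of_preconnected_of_eventuallyEq
    ((hg.comp hd.differentiableOn hline).analyticOnNhd isOpen_ball)
    (convex_ball 0 _).isPreconnected (mem_ball_self (by norm_num)) (hcont.eventually ha)
    (show (1 : ℂ) ∈ ball (0 : ℂ) (3 / 2) by norm_num)
  simpa using key

/-- The indices of an exhausting family of sets eventually cover compacta along an ultrafilter. -/
theorem exists_ultrafilter_eventually_subset {ι E : Type*} [TopologicalSpace E] {X : Set E}
    {W : ι → Set E} (hW : ∀ L, IsCompact L → L ⊆ X → ∃ s, L ⊆ W s) :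
    ∃ 𝒰 : Ultrafilter ι, ∀ L, IsCompact L → L ⊆ X → ∀ᶠ k in 𝒰, L ⊆ W k := by
  let l : Filter ι := ⨅ L : {L : Set E // IsCompact L ∧ L ⊆ X}, 𝓟 {k | L.1 ⊆ W k}
  have : Nonempty {L : Set E // IsCompact L ∧ L ⊆ X} := ⟨⟨∅, isCompact_empty, empty_subset _⟩⟩
  have hl : l.NeBot := by
    refine iInf_neBot_of_directed' (fun L M => ?_) fun L => ?_
    · exact ⟨⟨L.1 ∪ M.1, L.2.1.union M.2.1, union_subset L.2.2 M.2.2⟩,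
        principal_mono.2 fun k hk => subset_union_left.trans hk,
        principal_mono.2 fun k hk => subset_union_right.trans hk⟩
    · exact principal_neBot_iff.2 (hW L.1 L.2.1 L.2.2)
  exact ⟨Ultrafilter.of l, fun L hL hLX => Ultrafilter.of_le l
    (mem_iInf_of_mem (⟨L, hL, hLX⟩ : {L : Set E // IsCompact L ∧ L ⊆ X}) (mem_principal_self _))⟩

theorem IsCompact.exists_tendsto_ultrafilter {ι E : Type*} [TopologicalSpace E] {K : Set E}
    (hK : IsCompact K) (𝒰 : Ultrafilter ι) {u : ι → E} (hu : ∀ i, u i ∈ K) :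
    ∃ x ∈ K, Tendsto u 𝒰 (𝓝 x) :=
  hK.ultrafilter_le_nhds (𝒰.map u)
    (le_principal_iff.2 (Eventually.of_forall (f := (𝒰 : Filter ι)) hu : K ∈ 𝒰.map u))

end Exhaustion

section LimitsOfInverses

variable {n : ℕ} {D X : Set (Fin n → ℂ)}

theorem differentiableOn_invFunOn_image (hD : IsOpen D) {f : (Fin n → ℂ) → (Fin n → ℂ)}
    (hf : DifferentiableOn ℂ f D) (hinj : InjOn f D) :
    DifferentiableOn ℂ (Function.invFunOn f D) (f '' D) := by
  rintro _ ⟨x, hx, rfl⟩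
  obtain ⟨A, -, hA⟩ :=
    hasFDerivAt_invFunOn hD hf hinj hx (bijective_fderiv_of_injOn rfl hD hf hinj hx)
  exact hA.differentiableAt.differentiableWithinAt

theorem det_fderiv_invFunOn_mul (hD : IsOpen D) {f : (Fin n → ℂ) → (Fin n → ℂ)}
    (hf : DifferentiableOn ℂ f D) (hinj : InjOn f D) {x : Fin n → ℂ} (hx : x ∈ D) :
    (fderiv ℂ (Function.invFunOn f D) (f x)).det * (fderiv ℂ f x).det = 1 := by
  obtain ⟨A, hA, hA'⟩ :=
    hasFDerivAt_invFunOn hD hf hinj hx (bijective_fderiv_of_injOn rfl hD hf hinj hx)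
  rw [hA'.fderiv, ← hA]
  exact LinearEquiv.det_symm_mul_det A.toLinearEquiv

/-- Locally uniform limits of inverses of embeddings into a domain with nonvanishing Bergman
kernel have nonvanishing Jacobian. -/
theorem det_fderiv_ne_zero_of_tendstoUniformlyOn {ι : Type*} {l : Filter ι} [l.NeBot]
    (hD : IsOpen D) {F : ι → (Fin n → ℂ) → (Fin n → ℂ)}
    (hF : ∀ k, DifferentiableOn ℂ (F k) D ∧ InjOn (F k) D ∧ F k '' D ⊆ X)
    {g : (Fin n → ℂ) → (Fin n → ℂ)} {x : Fin n → ℂ} {R : ℝ} (hR : 0 < R)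
    (hg : TendstoUniformlyOn (fun k => Function.invFunOn (F k) D) g l (ball x R))
    (hd : ∀ᶠ k in l, DifferentiableOn ℂ (Function.invFunOn (F k) D) (ball x R))
    (hx : ∀ᶠ k in l, x ∈ F k '' D) (hgx : g x ∈ D) {u : (Fin n → ℂ) → ℂ} (hu : MemA2 X u)
    (hux : u x ≠ 0) : (fderiv ℂ g x).det ≠ 0 := by
  obtain ⟨ρ, hρ, hρD⟩ := Metric.isOpen_iff.1 hD _ hgx
  obtain ⟨B, hB, hBound⟩ := exists_norm_det_fderiv_le hu.1 hu.2 hux (half_pos hρ)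
  have hlim : Tendsto (fun k => ‖(fderiv ℂ (Function.invFunOn (F k) D) x).det‖) l
      (𝓝 ‖(fderiv ℂ g x).det‖) :=
    ((ContinuousLinearMap.continuous_det.tendsto _).comp
      ((tendstoUniformlyOn_fderiv_half_ball hR hg hd).2.tendsto_at
        (mem_ball_self (half_pos hR)))).norm
  refine norm_pos_iff.1 ((inv_pos.2 hB).trans_le (ge_of_tendsto hlim ?_))
  filter_upwards [hx, (hg.tendsto_at (mem_ball_self hR)).eventually
    (ball_mem_nhds _ (half_pos hρ))] with k hk hkρ
  obtain ⟨y, hy, rfl⟩ := hk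
  obtain ⟨hFd, hFi, hFX⟩ := hF k
  rw [hFi.leftInvOn_invFunOn hy] at hkρ
  have hsub : ball y (ρ / 2) ⊆ D := fun w hw => hρD <| by
    rw [mem_ball] at hw ⊢
    linarith [dist_triangle w y (g (F k y))]
  have hle := hBound (F k) y (hFd.mono hsub) (hFi.mono hsub)
    (fun w hw => hFX (mem_image_of_mem _ (hsub hw))) rfl
  have hmul := congrArg norm (det_fderiv_invFunOn_mul hD hFd hFi hy)
  rw [norm_mul, norm_one] at hmul
  rw [inv_le_iff_one_le_mul₀ hB, ← hmul]
  gcongr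

/-- Locally uniform limits of injective maps are injective if the derivative is invertible. -/
theorem injOn_of_tendstoUniformlyOn {E F ι : Type*} [NormedAddCommGroup E] [NormedSpace ℂ E]
    [FiniteDimensional ℂ E] [NormedAddCommGroup F] [NormedSpace ℂ F]
    [FiniteDimensional ℂ F] {l : Filter ι} [l.NeBot] {U : Set E} {f : ι → E → F} {g : E → F}
    (hfg : ∀ a ∈ U, ∃ R > 0, ball a R ⊆ U ∧ TendstoUniformlyOn f g l (ball a R) ∧
      ∀ᶠ k in l, DifferentiableOn ℂ (f k) (ball a R))
    (hinj : ∀ L, IsCompact L → L ⊆ U → ∀ᶠ k in l, InjOn (f k) L)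
    (hg : ∀ x ∈ U, Function.Surjective (fderiv ℂ g x)) : InjOn g U := by
  intro a ha b hb hab
  by_contra hne
  obtain ⟨R, hR, hRU, hlim, hd⟩ := hfg b hb
  obtain ⟨Ra, hRa, -, hlima, -⟩ := hfg a ha
  have hpos : 0 < dist a b := dist_pos.2 hne
  obtain ⟨r, hr, hrmin⟩ := exists_between (lt_min hR hpos)
  have hrU : closedBall b r ⊆ U :=
    (closedBall_subset_ball (hrmin.trans_le (min_le_left _ _))).trans hRU
  obtain ⟨ε, hε, hcov⟩ := eventually_closedBall_subset_image hR hr hlim hd (hg b hb)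
  have hclose := (hlima.tendsto_at (mem_ball_self hRa)).eventually (closedBall_mem_nhds _ hε)
  obtain ⟨k, hk, hka, hki⟩ := (hcov.and (hclose.and (hinj (insert a (closedBall b r))
    ((isCompact_closedBall b r).insert a) (insert_subset ha hrU)))).exists
  obtain ⟨c, hc, hca⟩ := hk (hab ▸ hka)
  have hceq : c = a := hki (mem_insert_of_mem _ hc) (mem_insert _ _) hca
  rw [hceq, mem_closedBall] at hc
  exact hc.not_gt (hrmin.trans_le (min_le_right _ _))

end LimitsOfInverses

section Surjectivity

variable {n : ℕ} {D X : Set (Fin n → ℂ)}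

/-- If embeddings of a taut domain cover compacta of `X` and their inverses converge, then the
limit of the inverses is onto. -/
theorem IsTaut.subset_image_of_tendstoUniformlyOn {ι : Type*} (hD : IsOpen D)
    (hDc : IsPreconnected D) (htaut : IsTaut D) (𝒰 : Ultrafilter ι) (hX : IsOpen X)
    {F : ι → (Fin n → ℂ) → (Fin n → ℂ)}
    (hF : ∀ k, DifferentiableOn ℂ (F k) D ∧ InjOn (F k) D ∧ F k '' D ⊆ X)
    (hcov : ∀ L, IsCompact L → L ⊆ X → ∀ᶠ k in 𝒰, L ⊆ F k '' D)
    {g : (Fin n → ℂ) → (Fin n → ℂ)} (hgd : DifferentiableOn ℂ g X) (hgX : MapsTo g X D)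
    (hg : ∀ a ∈ X, ∃ R > 0, ball a R ⊆ X ∧
      TendstoUniformlyOn (fun k => Function.invFunOn (F k) D) g 𝒰 (ball a R) ∧
      ∀ᶠ k in 𝒰, DifferentiableOn ℂ (Function.invFunOn (F k) D) (ball a R))
    (hg' : ∀ x ∈ X, Function.Surjective (fderiv ℂ g x))
    {z : ι → Fin n → ℂ} {z₀ x₀ : Fin n → ℂ} (hz₀ : z₀ ∈ D) (hx₀ : x₀ ∈ X)
    (hz : Tendsto z 𝒰 (𝓝 z₀)) (hFz : Tendsto (fun k => F k (z k)) 𝒰 (𝓝 x₀)) :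
    D ⊆ g '' X := by
  have hFm : ∀ k, MapsTo (F k) D X := fun k w hw => (hF k).2.2 (mem_image_of_mem _ hw)
  have hH : ∀ k, DifferentiableOn ℂ (g ∘ F k) D ∧ MapsTo (g ∘ F k) D D := fun k =>
    ⟨hgd.comp (hF k).1 (hFm k), hgX.comp (hFm k)⟩
  obtain ⟨δ, hδ, hδD⟩ := Metric.nhds_basis_closedBall.mem_iff.1 (hD.mem_nhds (hgX hx₀))
  have hgc : Tendsto (fun k => g (F k (z k))) 𝒰 (𝓝 (g x₀)) :=
    ((hgd.differentiableAt (hX.mem_nhds hx₀)).continuousAt.tendsto).comp hFz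
  obtain ⟨h, hhd, -, hh⟩ := htaut.exists_tendstoUniformlyOn_of_ultrafilter hD 𝒰
    (f := fun k => g ∘ F k) (y := z) hD hDc
    (fun a r har => Eventually.of_forall fun k =>
      ⟨(hH k).1.mono (ball_subset_closedBall.trans har),
        (hH k).2.mono_left (ball_subset_closedBall.trans har)⟩)
    hz₀ hz (isCompact_closedBall (g x₀) δ) hδD (hgc.eventually (closedBall_mem_nhds _ hδ))
  obtain ⟨R, hR, hRX, hlim, hd⟩ := hg x₀ hx₀
  obtain ⟨ε, hε, hball⟩ :=
    eventually_closedBall_subset_image hR (half_pos hR) hlim hd (hg' x₀ hx₀)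
  have hRX' : closedBall x₀ (R / 2) ⊆ ball x₀ R := closedBall_subset_ball (half_lt_self hR)
  have hid : h =ᶠ[𝓝 (g x₀)] id := by
    filter_upwards [ball_mem_nhds _ hε, hD.mem_nhds (hgX hx₀)] with y hy hyD
    obtain ⟨S, hS, -, hSlim, -⟩ := hh y hyD
    refine tendsto_nhds_unique (hSlim.tendsto_at (mem_ball_self hS)) ?_
    refine Metric.tendsto_nhds.2 fun η hη => ?_
    filter_upwards [hball, Metric.tendstoUniformlyOn_iff.1 hlim η hη,
      hcov _ (isCompact_closedBall x₀ (R / 2)) (hRX'.trans hRX)] with k hk hkη hkc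
    obtain ⟨x, hx, rfl⟩ := hk (ball_subset_closedBall hy)
    have := hkη x (hRX' hx)
    obtain ⟨w, hw, rfl⟩ := hkc hx
    rwa [(hF k).2.1.leftInvOn_invFunOn hw] at this ⊢
  have hhid : EqOn h id D := hhd.eqOn_of_isPreconnected_of_eventuallyEq hD hDc
    differentiableOn_id (hgX hx₀) hid
  intro q hq
  obtain ⟨S, hS, -, hSlim, hSd⟩ := hh q hq
  obtain ⟨r, hr, hrD⟩ := Metric.nhds_basis_closedBall.mem_iff.1 (hD.mem_nhds hq)
  have hqid : fderiv ℂ h q = ContinuousLinearMap.id ℂ _ := by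
    rw [(hhid.eventuallyEq_of_mem (hD.mem_nhds hq)).fderiv_eq, fderiv_id]
  obtain ⟨ε', hε', hcover⟩ := eventually_closedBall_subset_image hS hr hSlim hSd
    (by rw [hqid]; exact Function.surjective_id)
  obtain ⟨k, hk⟩ := hcover.exists
  rw [hhid hq] at hk
  obtain ⟨w, hw, hwq⟩ := hk (mem_closedBall_self hε'.le)
  exact ⟨F k w, hFm k (hrD hw), hwq⟩

end Surjectivity

/-- if a taut domain `D` admits biholomorphisms onto subdomains of `X`
exhausting `X`, with base points staying in compacta, and the Bergman kernel of `X` is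
nonvanishing on the diagonal, then `X` is biholomorphic to `D`. -/
theorem biholomorphic_of_exhausting_embeddings {n : ℕ} (D X : Set (Fin n → ℂ))
    (hDopen : IsOpen D) (hDconn : IsConnected D)
    (hXopen : IsOpen X) (hXconn : IsConnected X)
    (htaut : IsTaut D)
    (K₁ K₂ : Set (Fin n → ℂ))
    (hK₁ : IsCompact (closure K₁)) (hK₁D : closure K₁ ⊆ D)
    (hK₂ : IsCompact (closure K₂)) (hK₂X : closure K₂ ⊆ X)
    (F : ℕ → (Fin n → ℂ) → (Fin n → ℂ))
    (hF : ∀ k, DifferentiableOn ℂ (F k) D ∧ Set.InjOn (F k) D ∧ F k '' D ⊆ X)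
    (hFz : ∀ k, ∃ z ∈ K₁, F k z ∈ K₂)
    (hFexh : ∀ L : Set (Fin n → ℂ), IsCompact L → L ⊆ X → ∃ s, L ⊆ F s '' D)
    (KX : (Fin n → ℂ) → (Fin n → ℂ) → ℂ) (hKX : IsBergmanKernel X KX)
    (hnz : ∀ x ∈ X, KX x x ≠ 0) :
    Biholomorphic D X := by
  obtain ⟨𝒰, hcov⟩ := exists_ultrafilter_eventually_subset hFexh
  choose z hzK hFzK using hFz
  obtain ⟨z₀, hz₀, hz⟩ := hK₁.exists_tendsto_ultrafilter 𝒰 fun k => subset_closure (hzK k)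
  obtain ⟨x₀, hx₀, hx⟩ := hK₂.exists_tendsto_ultrafilter 𝒰 fun k => subset_closure (hFzK k)
  have hmaps : ∀ k, MapsTo (Function.invFunOn (F k) D) (F k '' D) D := by
    rintro k _ ⟨w, hw, rfl⟩
    rwa [(hF k).2.1.leftInvOn_invFunOn hw]
  obtain ⟨g, hgd, hgD, hg⟩ := htaut.exists_tendstoUniformlyOn_of_ultrafilter hDopen 𝒰
    (f := fun k => Function.invFunOn (F k) D) (y := fun k => F k (z k)) hXopen
    hXconn.isPreconnected
    (fun a r har => (hcov _ (isCompact_closedBall a r) har).mono fun k hk =>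
      ⟨(differentiableOn_invFunOn_image hDopen (hF k).1 (hF k).2.1).mono
        (ball_subset_closedBall.trans hk),
        (hmaps k).mono_left (ball_subset_closedBall.trans hk)⟩)
    (hK₂X hx₀) hx hK₁ hK₁D (Eventually.of_forall fun k => by
      rw [(hF k).2.1.leftInvOn_invFunOn (hK₁D (subset_closure (hzK k)))]
      exact subset_closure (hzK k))
  have hsurj : ∀ x ∈ X, Function.Surjective (fderiv ℂ g x) := fun x hx => by
    obtain ⟨R, hR, -, hlim, hd⟩ := hg x hx
    refine LinearMap.injective_iff_surjective.1
      (injective_of_continuousLinearMap_det_ne_zero (A := fderiv ℂ g x) ?_)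
    exact det_fderiv_ne_zero_of_tendstoUniformlyOn hDopen hF hR hlim hd
      ((hcov {x} isCompact_singleton (singleton_subset_iff.2 hx)).mono fun k hk =>
        singleton_subset_iff.1 hk) (hgD hx) (hKX.1 x hx) (hnz x hx)
  have hinj : InjOn g X := injOn_of_tendstoUniformlyOn hg
    (fun L hL hLX => (hcov L hL hLX).mono fun k hk =>
      (Function.invFunOn_injOn_image (F k) D).mono hk) hsurj
  have himage : g '' X = D := (image_subset_iff.2 hgD).antisymm
    (htaut.subset_image_of_tendstoUniformlyOn hDopen hDconn.isPreconnected 𝒰 hXopen hF hcov hgd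
      hgD hg hsurj (hK₁D hz₀) (hK₂X hx₀) hz hx)
  rw [← himage]
  exact ⟨Function.invFunOn g X, differentiableOn_invFunOn_image hXopen hgd hinj,
    Function.invFunOn_injOn_image g X, hinj.invFunOn_image subset_rfl⟩

end
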